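/- arXiv:1908.01650 — 8 statements merged into one kernel-verified Lean document; each statement's English description precedes it below -/
import Mathlib

section
/- Let C be a linear code over F_p. Then C is a minimal code if and only if for every pair of F_p-linearly independent codewords a, b in C one has Σ_{c∈F_p^*} wt(a + c·b) ≠ (p−1)·wt(a) − wt(b). -/
open Finset

/-- On one coordinate, the Hamming weights of `x + c * y` over all nonzero `c` add up to the
expected value plus a defect `p` exactly when `y ≠ 0` and `x = 0`. -/
theorem sum_ite_add_mul_ne_zero {p : ℕ} [Fact p.Prime] (x y : ZMod p) :
    (∑ c ∈ Finset.univ \ {(0 : ZMod p)}, (if x + c * y ≠ 0 then 1 else 0 : ℤ)) =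
      (p - 1) * (if x ≠ 0 then 1 else 0) - (if y ≠ 0 then 1 else 0) +
        p * (if y ≠ 0 ∧ x = 0 then 1 else 0) := by
  have hsub := Finset.sum_sdiff (f := fun c : ZMod p => (if x + c * y ≠ 0 then 1 else 0 : ℤ))
    (Finset.subset_univ {(0 : ZMod p)})
  rw [Finset.sum_singleton] at hsub
  rw [eq_sub_of_add_eq hsub]
  by_cases hy : y = 0
  · simp only [hy, mul_zero, add_zero, Finset.sum_const, Finset.card_univ, ZMod.card]
    simp
    split_ifs <;> ring
  · have hroot (c : ZMod p) : (if x + c * y ≠ 0 then 1 else 0 : ℤ) =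
        1 - if c = -x / y then 1 else 0 := by
      have h : x + c * y = 0 ↔ c = -x / y := by
        rw [eq_div_iff hy]
        constructor <;> intro h <;> linear_combination h
      by_cases hc : c = -x / y
      · rw [h.mpr hc, if_pos hc]
        simp
      · simp [hc, mt h.mp hc]
    have htotal : (∑ c : ZMod p, (if x + c * y ≠ 0 then 1 else 0 : ℤ)) = p - 1 := by
      simp_rw [hroot]
      simp [ZMod.card]
    rw [htotal]
    by_cases hx : x = 0 <;> simp [hx, hy]
    ring

/-- The Hamming weight as an integer sum of indicators. -/
theorem hammingNorm_eq_sum_ite {p n : ℕ} (a : Fin n → ZMod p) :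
    (hammingNorm a : ℤ) = ∑ i, if a i ≠ 0 then 1 else 0 := by
  rw [hammingNorm, Finset.card_filter]
  push_cast
  rfl

/-- The sum of the weights of `a + c • b` over all nonzero `c`. -/
theorem sum_hammingNorm_add_smul {p n : ℕ} [Fact p.Prime] (a b : Fin n → ZMod p) :
    (∑ c ∈ Finset.univ \ {(0 : ZMod p)}, (hammingNorm (a + c • b) : ℤ)) =
      (p - 1) * (hammingNorm a : ℤ) - (hammingNorm b : ℤ) +
        p * (#{i | b i ≠ 0 ∧ a i = 0} : ℤ) := by
  simp_rw [hammingNorm_eq_sum_ite, Pi.add_apply, Pi.smul_apply, smul_eq_mul]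
  rw [Finset.sum_comm, Finset.card_filter]
  push_cast
  simp_rw [sum_ite_add_mul_ne_zero, Finset.sum_add_distrib, Finset.sum_sub_distrib,
    Finset.mul_sum]

/-- The weight identity holds without defect exactly when the support of `b` lies in that
of `a`. -/
theorem sum_hammingNorm_add_smul_eq_iff {p n : ℕ} [Fact p.Prime] (a b : Fin n → ZMod p) :
    (∑ c ∈ Finset.univ \ {(0 : ZMod p)}, (hammingNorm (a + c • b) : ℤ)) =
      (p - 1) * (hammingNorm a : ℤ) - (hammingNorm b : ℤ) ↔ ∀ i, b i ≠ 0 → a i ≠ 0 := by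
  have hp : (p : ℤ) ≠ 0 := mod_cast (Fact.out : p.Prime).ne_zero
  rw [sum_hammingNorm_add_smul, add_eq_left, mul_eq_zero, or_iff_right hp, Nat.cast_eq_zero,
    Finset.card_eq_zero, Finset.filter_eq_empty_iff]
  simp

/-- A linear code `C` over `F_p` is minimal (every nonzero codeword `a`
is covered only by its scalar multiples within `C`) if and only if for every pair of
`F_p`-linearly independent codewords `a, b ∈ C` one has
`Σ_{c ∈ F_p^*} wt(a + c • b) ≠ (p−1)·wt(a) − wt(b)`. -/
theorem minimal_code_iff_weight_condition {p n : ℕ} [Fact p.Prime]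
    (C : Submodule (ZMod p) (Fin n → ZMod p)) :
    (∀ a ∈ C, a ≠ 0 → ∀ b ∈ C, (∀ i, b i ≠ 0 → a i ≠ 0) → ∃ c : ZMod p, b = c • a) ↔
      (∀ a ∈ C, ∀ b ∈ C, LinearIndependent (ZMod p) ![a, b] →
        (∑ c ∈ Finset.univ \ {(0 : ZMod p)}, (hammingNorm (a + c • b) : ℤ)) ≠
          (p - 1) * (hammingNorm a : ℤ) - (hammingNorm b : ℤ)) := by
  simp only [ne_eq, sum_hammingNorm_add_smul_eq_iff]
  constructor
  · intro h a ha b hb hab hsupp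
    have ha0 : a ≠ 0 := hab.ne_zero 0
    obtain ⟨c, hc⟩ := h a ha ha0 b hb hsupp
    exact (LinearIndependent.pair_iff' ha0).mp hab c hc.symm
  · intro h a ha ha0 b hb hsupp
    by_contra! hne
    exact h a ha b hb ((LinearIndependent.pair_iff' ha0).mpr fun c => (hne c).symm) hsupp
end

section
/- Let p = 2 and let f : F_q → F_2 satisfy condition (★). Then the code C_f has length q−1 and dimension m+1 over F_2, and the multiset of Hamming weights of its codewords (with multiplicity) is the multiset union {(q − f̂(w))/2 : w ∈ F_q} ∪ {2^{m−1} : w ∈ F_q^*} ∪ {0}. -/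
open Finset

private lemma neg_one_pow_val_add (a b : ZMod 2) :
    (-1 : ℤ) ^ (a + b).val = (-1) ^ a.val * (-1) ^ b.val := by
  revert a b
  decide

private lemma two_mul_ite_ne_zero (a : ZMod 2) :
    2 * (if a ≠ 0 then 1 else 0 : ℤ) = 1 - (-1) ^ a.val := by
  revert a
  decide

/-- A function vanishing at `0` has Hamming weight determined by its sign sum. -/
lemma two_mul_hammingNorm_eq_card_sub_sum {V : Type*} [Zero V] [Fintype V] [DecidableEq V]
    (g : V → ZMod 2) (hg : g 0 = 0) :
    2 * (hammingNorm (fun x : {x : V // x ≠ 0} => g x.1) : ℤ) =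
      Fintype.card V - ∑ x : V, (-1 : ℤ) ^ (g x).val := by
  have h : (hammingNorm (fun x : {x : V // x ≠ 0} => g x.1) : ℤ) =
      ∑ x : V, if g x ≠ 0 then 1 else 0 := by
    rw [Fintype.sum_eq_add_sum_subtype_ne _ (0 : V), hammingNorm, Finset.card_filter]
    simp [hg]
  rw [h, Finset.mul_sum, Finset.sum_congr rfl fun x _ => two_mul_ite_ne_zero (g x)]
  simp

/-- The signs of a nonzero additive functional to `F_2` cancel. -/
lemma sum_neg_one_pow_val_eq_zero {V : Type*} [AddGroup V] [Fintype V]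
    (l : V →+ ZMod 2) (hl : l ≠ 0) : ∑ x : V, (-1 : ℤ) ^ (l x).val = 0 := by
  obtain ⟨y, hy⟩ : ∃ y, l y ≠ 0 := by
    by_contra! h
    exact hl (AddMonoidHom.ext h)
  have hy1 : l y = 1 := by
    generalize l y = a at hy
    revert a
    decide
  have h := Equiv.sum_comp (Equiv.addRight y) fun x => (-1 : ℤ) ^ (l x).val
  simp only [Equiv.coe_addRight, map_add, neg_one_pow_val_add, hy1, ← Finset.sum_mul,
    ZMod.val_one] at h
  linarith

lemma map_univ_val_eq_sum_singleton {α β : Type*} [Fintype α] (g : α → β) :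
    Multiset.map g (Finset.univ : Finset α).val = ∑ x : α, ({g x} : Multiset β) := by
  rw [← Multiset.sum_map_singleton (Multiset.map g _), Multiset.map_map]
  rfl

/-- The linear encoder `(u, v) ↦ (u f(x) - Tr(vx))` on the nonzero elements. -/
noncomputable def traceEncoder {F : Type*} [Field F] [Algebra (ZMod 2) F] (f : F → ZMod 2) :
    ZMod 2 × F →ₗ[ZMod 2] ({x : F // x ≠ 0} → ZMod 2) where
  toFun uv x := uv.1 * f x.1 - Algebra.trace (ZMod 2) F (uv.2 * x.1)
  map_add' a b := by
    ext x
    simp only [Prod.fst_add, Prod.snd_add, add_mul, map_add, Pi.add_apply]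
    ring
  map_smul' r a := by
    ext x
    simp only [Prod.smul_fst, Prod.smul_snd, smul_mul_assoc, map_smul, Pi.smul_apply,
      RingHom.id_apply, smul_sub]

lemma exists_trace_mul_ne_zero {F : Type*} [Field F] [Finite F] [Algebra (ZMod 2) F]
    {v : F} (hv : v ≠ 0) : ∃ x, Algebra.trace (ZMod 2) F (v * x) ≠ 0 := by
  obtain ⟨y, hy⟩ := Algebra.trace_surjective (ZMod 2) F 1
  exact ⟨v⁻¹ * y, by simp [mul_inv_cancel_left₀ hv, hy]⟩

lemma traceEncoder_injective {F : Type*} [Field F] [Finite F] [Algebra (ZMod 2) F]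
    {f : F → ZMod 2} (hf0 : f 0 = 0)
    (hf : ∀ w : F, f ≠ fun x => Algebra.trace (ZMod 2) F (w * x)) :
    Function.Injective (traceEncoder f) := by
  rw [injective_iff_map_eq_zero]
  rintro ⟨u, v⟩ h
  have key (x : F) : u * f x - Algebra.trace (ZMod 2) F (v * x) = 0 := by
    by_cases hx : x = 0
    · simp [hx, hf0]
    · exact congrFun h ⟨x, hx⟩
  obtain rfl | rfl : u = 0 ∨ u = 1 := by
    clear h key
    revert u
    decide
  · by_cases hv : v = 0
    · simp [hv]
    · obtain ⟨x, hx⟩ := exists_trace_mul_ne_zero hv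
      exact absurd (by simpa using key x) hx
  · exact absurd (funext fun x => by simpa [sub_eq_zero] using key x) (hf v)

/-- For `p = 2` and `f : F_q → F_2` satisfying condition (★)
(`f 0 = 0` and `f` is not a trace-linear function), the code
`C_f = {(u f(x) − Tr(vx))_{x ∈ F_q^*} : u ∈ F_2, v ∈ F_q}` has length `q − 1`,
dimension `m + 1`, and its multiset of Hamming weights (with multiplicity) is
`{(q − f̂(w))/2 : w ∈ F_q} ∪ {2^{m−1} : w ∈ F_q^*} ∪ {0}`. -/
theorem binary_code_from_boolean_function_parameters
    {m : ℕ} (hm : 0 < m) (F : Type) [Field F] [Fintype F] [DecidableEq F]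
    [Algebra (ZMod 2) F] (hF : Fintype.card F = 2 ^ m)
    (f : F → ZMod 2) (hf0 : f 0 = 0)
    (hf : ∀ w : F, f ≠ fun x => Algebra.trace (ZMod 2) F (w * x)) :
    -- the absolute trace
    let Tr : F → ZMod 2 := fun x => Algebra.trace (ZMod 2) F x
    -- the Walsh transform of `f` (with `ζ_2 = −1`)
    let W : F → ℤ := fun w => ∑ x : F, (-1 : ℤ) ^ ((f x).val + (Tr (w * x)).val)
    -- the codewords of `C_f`, indexed by `x ∈ F_q^*`
    let c : ZMod 2 × F → ({x : F // x ≠ 0} → ZMod 2) :=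
      fun uv x => uv.1 * f x.1 - Tr (uv.2 * x.1)
    -- length `q − 1`
    (Fintype.card {x : F // x ≠ 0} = 2 ^ m - 1) ∧
    -- dimension `m + 1`
    (Module.finrank (ZMod 2) (Submodule.span (ZMod 2) (Set.range c)) = m + 1) ∧
    -- weight distribution
    (Multiset.map (fun uv => (hammingNorm (c uv) : ℤ)) (Finset.univ : Finset (ZMod 2 × F)).val =
      Multiset.map (fun w : F => ((2 ^ m : ℤ) - W w) / 2) (Finset.univ : Finset F).val +
      Multiset.map (fun _ : {x : F // x ≠ 0} => (2 ^ (m - 1) : ℤ))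
        (Finset.univ : Finset {x : F // x ≠ 0}).val +
      {0}) := by
  intro Tr W c
  have hcard : Fintype.card {x : F // x ≠ 0} = 2 ^ m - 1 := by
    rw [Fintype.card_subtype_compl, Fintype.card_subtype_eq, hF]
  have hrank : Module.finrank (ZMod 2) F = m := by
    have h := Module.card_eq_pow_finrank (K := ZMod 2) (V := F)
    rw [hF, ZMod.card] at h
    exact (Nat.pow_right_injective le_rfl h).symm
  have hnorm (u : ZMod 2) (v : F) :
      2 * (hammingNorm (c (u, v)) : ℤ) = 2 ^ m - ∑ x : F, (-1 : ℤ) ^ (u * f x - Tr (v * x)).val := by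
    have h := two_mul_hammingNorm_eq_card_sub_sum (fun x : F => u * f x - Tr (v * x))
      (by simp [hf0, Tr])
    rw [hF] at h
    exact_mod_cast h
  have hone (v : F) : (hammingNorm (c (1, v)) : ℤ) = (2 ^ m - W v) / 2 := by
    have h := hnorm 1 v
    simp only [one_mul, CharTwo.sub_eq_add, neg_one_pow_val_add, ← pow_add] at h
    change _ = 2 ^ m - W v at h
    omega
  have hzero (v : F) (hv : v ≠ 0) : (hammingNorm (c (0, v)) : ℤ) = 2 ^ (m - 1) := by
    have h := hnorm 0 v
    obtain ⟨y, hy⟩ := exists_trace_mul_ne_zero hv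
    have hs := sum_neg_one_pow_val_eq_zero
      ((Algebra.trace (ZMod 2) F).toAddMonoidHom.comp (AddMonoidHom.mulLeft v))
      fun h0 => hy (DFunLike.congr_fun h0 y)
    change ∑ x : F, (-1 : ℤ) ^ (Tr (v * x)).val = 0 at hs
    simp only [zero_mul, zero_sub, CharTwo.neg_eq, hs, sub_zero] at h
    obtain ⟨k, rfl⟩ := Nat.exists_eq_succ_of_ne_zero hm.ne'
    rw [Nat.succ_eq_add_one, pow_succ] at h
    rw [Nat.succ_eq_add_one, Nat.add_sub_cancel]
    linarith
  have hc0 : (hammingNorm (c (0, 0)) : ℤ) = 0 := by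
    have : c (0, 0) = 0 := by
      ext x
      simp [c, Tr]
    simp [this]
  refine ⟨hcard, ?_, ?_⟩
  · have hspan : Submodule.span (ZMod 2) (Set.range c) = LinearMap.range (traceEncoder f) := by
      rw [← Submodule.span_eq (LinearMap.range (traceEncoder f)), LinearMap.coe_range]
      rfl
    rw [hspan, LinearMap.finrank_range_of_inj (traceEncoder_injective hf0 hf),
      Module.finrank_prod, Module.finrank_self, hrank, add_comm]
  · simp only [map_univ_val_eq_sum_singleton]
    have huniv (g : ZMod 2 → Multiset ℤ) : ∑ u, g u = g 0 + g 1 := Fin.sum_univ_two g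
    rw [Fintype.sum_prod_type, huniv, Fintype.sum_eq_add_sum_subtype_ne _ (0 : F), hc0,
      Finset.sum_congr rfl fun (v : {x : F // x ≠ 0}) _ => by rw [hzero v.1 v.2],
      Finset.sum_congr rfl fun (v : F) _ => by rw [hone v]]
    abel
end

section
/- Let p = 2 and let f : F_q → F_2 satisfy condition (★). Then the code C_f is a minimal code if and only if f̂(h) + f̂(l) ≠ q and f̂(h) − f̂(l) ≠ q for every pair of distinct elements h and l of F_q. -/
open Finset

/-- The sum of the signs `(-1)^{g(x)}` of a Boolean function. -/
def signSum {α : Type*} [Fintype α] (g : α → ZMod 2) : ℤ := ∑ x, (-1 : ℤ) ^ (g x).val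

/-- The Boolean function `u f(x) - Tr(v x)` on the whole field. -/
noncomputable def wordFun {F : Type*} [Field F] [Algebra (ZMod 2) F] (f : F → ZMod 2)
    (u : ZMod 2) (v : F) : F → ZMod 2 :=
  fun x => u * f x - Algebra.trace (ZMod 2) F (v * x)

/-- The support of `b` lies in that of `a` exactly when the weights of `b` and `a + b` add up
to the weight of `a`. -/
theorem signSum_add_sub_eq_card_iff {α : Type*} [Fintype α] (a b : α → ZMod 2) :
    signSum b + signSum (a + b) - signSum a = Fintype.card α ↔ ∀ x, b x ≠ 0 → a x ≠ 0 := by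
  have hle : ∀ s t : ZMod 2,
      (-1 : ℤ) ^ t.val + (-1) ^ (s + t).val - (-1) ^ s.val ≤ 1 := by decide
  have heq : ∀ s t : ZMod 2,
      (-1 : ℤ) ^ t.val + (-1) ^ (s + t).val - (-1) ^ s.val = 1 ↔ (t ≠ 0 → s ≠ 0) := by decide
  have hcard : (Fintype.card α : ℤ) = ∑ _x : α, (1 : ℤ) := by simp
  rw [hcard, signSum, signSum, signSum, ← sum_add_distrib, ← sum_sub_distrib]
  simp only [Pi.add_apply]
  rw [sum_eq_sum_iff_of_le fun x _ => hle (a x) (b x)]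
  simp [heq]

section WordFun

variable {F : Type*} [Field F] [Algebra (ZMod 2) F] (f : F → ZMod 2)

theorem wordFun_add (u u' : ZMod 2) (v v' : F) :
    wordFun f u v + wordFun f u' v' = wordFun f (u + u') (v + v') := by
  ext x
  simp only [wordFun, Pi.add_apply, add_mul, map_add]
  ring

theorem wordFun_zero : wordFun f 0 0 = 0 := by
  ext x
  simp [wordFun]

variable [Fintype F]

theorem signSum_wordFun_zero (v : F) (hv : v ≠ 0) : signSum (wordFun f 0 v) = 0 := by
  obtain ⟨y, hy⟩ := Algebra.trace_surjective (ZMod 2) F 1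
  have hneg : signSum (wordFun f 0 v) = -signSum (wordFun f 0 v) := by
    have hflip : ∀ s : ZMod 2, (-1 : ℤ) ^ (0 - (s + 1)).val = -(-1) ^ (0 - s).val := by decide
    conv_lhs => rw [signSum, ← Equiv.sum_comp (Equiv.addRight (v⁻¹ * y))]
    rw [signSum, ← sum_neg_distrib]
    refine sum_congr rfl fun x _ => ?_
    simp only [wordFun, zero_mul, Equiv.coe_addRight, mul_add, mul_inv_cancel_left₀ hv, map_add,
      hy, hflip]
  omega

theorem wordFun_eq_zero_iff
    (hf : ∀ w : F, f ≠ fun x => Algebra.trace (ZMod 2) F (w * x)) (u : ZMod 2) (v : F) :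
    wordFun f u v = 0 ↔ u = 0 ∧ v = 0 := by
  refine ⟨fun h => ?_, fun ⟨hu, hv⟩ => by rw [hu, hv, wordFun_zero]⟩
  have hu : u = 0 := by
    by_contra hu
    have hu1 : u = 1 := (by decide : ∀ s : ZMod 2, s ≠ 0 → s = 1) u hu
    refine hf v (funext fun x => ?_)
    simpa [wordFun, hu1, sub_eq_zero] using congrFun h x
  subst hu
  refine ⟨rfl, ?_⟩
  by_contra hv
  have h0 := signSum_wordFun_zero f v hv
  rw [h] at h0
  simp [signSum] at h0

end WordFun


/-- For `p = 2` and `f : F_q → F_2` satisfying condition (★),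
the code `C_f` is minimal if and only if `f̂(h) + f̂(l) ≠ q` and `f̂(h) − f̂(l) ≠ q`
for every pair of distinct elements `h, l ∈ F_q`. -/
theorem binary_code_from_boolean_function_minimal_iff
    {m : ℕ} (hm : 0 < m) (F : Type) [Field F] [Fintype F] [DecidableEq F]
    [Algebra (ZMod 2) F] (hF : Fintype.card F = 2 ^ m)
    (f : F → ZMod 2) (hf0 : f 0 = 0)
    (hf : ∀ w : F, f ≠ fun x => Algebra.trace (ZMod 2) F (w * x)) :
    -- the absolute trace
    let Tr : F → ZMod 2 := fun x => Algebra.trace (ZMod 2) F x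
    -- the Walsh transform of `f` (with `ζ_2 = −1`)
    let W : F → ℤ := fun w => ∑ x : F, (-1 : ℤ) ^ ((f x).val + (Tr (w * x)).val)
    -- the codewords of `C_f`, indexed by `x ∈ F_q^*`
    let c : ZMod 2 × F → ({x : F // x ≠ 0} → ZMod 2) :=
      fun uv x => uv.1 * f x.1 - Tr (uv.2 * x.1)
    let Cf : Set ({x : F // x ≠ 0} → ZMod 2) := Set.range c
    -- `C_f` is a minimal code
    (∀ a ∈ Cf, a ≠ 0 → ∀ b ∈ Cf, (∀ i, b i ≠ 0 → a i ≠ 0) → ∃ k : ZMod 2, b = k • a) ↔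
      (∀ h l : F, h ≠ l → W h + W l ≠ 2 ^ m ∧ W h - W l ≠ 2 ^ m) := by
  intro Tr W c Cf
  have : CharP F 2 := charP_of_injective_algebraMap (algebraMap (ZMod 2) F).injective 2
  have hW : ∀ w, W w = signSum (wordFun f 1 w) := fun w => by
    have hsign : ∀ s t : ZMod 2, (-1 : ℤ) ^ (s.val + t.val) = (-1) ^ (1 * s - t).val := by decide
    exact sum_congr rfl fun x _ => hsign _ _
  have hT : ∀ v, signSum (wordFun f 0 v) = if v = 0 then 2 ^ m else 0 := fun v => by
    split_ifs with hv
    · rw [hv, wordFun_zero]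
      simp [signSum, hF]
    · exact signSum_wordFun_zero f v hv
  have hc : ∀ u v u' v', c (u, v) = c (u', v') ↔ u = u' ∧ v = v' := fun u v u' v' => by
    rw [← CharTwo.add_eq_zero (a := u), ← CharTwo.add_eq_zero (a := v),
      ← wordFun_eq_zero_iff f hf, ← wordFun_add]
    constructor
    · intro h
      ext x
      by_cases hx : x = 0
      · simp [wordFun, hx, hf0]
      · have hxc : wordFun f u v x = wordFun f u' v' x := congrFun h ⟨x, hx⟩
        simp [hxc, CharTwo.add_self_eq_zero]
    · intro h
      ext x
      exact CharTwo.add_eq_zero.mp (congrFun h x.1)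
  have hc0 : c (0, 0) = 0 := by
    ext x
    simp [c, Tr]
  have hsupp : ∀ u v u' v', (∀ i, c (u', v') i ≠ 0 → c (u, v) i ≠ 0) ↔
      signSum (wordFun f u' v') + signSum (wordFun f (u + u') (v + v')) -
        signSum (wordFun f u v) = 2 ^ m := fun u v u' v' => by
    have hq : (2 : ℤ) ^ m = Fintype.card F := by simp [hF]
    rw [hq, ← wordFun_add, signSum_add_sub_eq_card_iff]
    refine ⟨fun h x hx => ?_, fun h i => h i.1⟩
    by_cases hx0 : x = 0
    · simp [wordFun, hx0, hf0] at hx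
    · exact h ⟨x, hx0⟩ hx
  have hsmul : ∀ a b : {x : F // x ≠ 0} → ZMod 2, (∃ k : ZMod 2, b = k • a) ↔ b = 0 ∨ b = a := by
    intro a b
    constructor
    · rintro ⟨k, rfl⟩
      rcases (by decide : ∀ s : ZMod 2, s = 0 ∨ s = 1) k with rfl | rfl <;> simp
    · rintro (rfl | rfl)
      · exact ⟨0, by simp⟩
      · exact ⟨1, by simp⟩
  have hmin : (∀ a ∈ Cf, a ≠ 0 → ∀ b ∈ Cf, (∀ i, b i ≠ 0 → a i ≠ 0) →
      ∃ k : ZMod 2, b = k • a) ↔ ∀ u v u' v', ¬(u = 0 ∧ v = 0) →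
      signSum (wordFun f u' v') + signSum (wordFun f (u + u') (v + v')) -
        signSum (wordFun f u v) = 2 ^ m → (u' = 0 ∧ v' = 0) ∨ (u' = u ∧ v' = v) := by
    simp only [Cf, Set.forall_mem_range, Prod.forall, hsmul, hsupp, ← hc0, hc, ne_eq]
    exact forall₂_congr fun u v => ⟨fun h u' v' hn => h hn u' v', fun h hn u' v' => h u' v' hn⟩
  rw [hmin]
  constructor
  · intro h v w hvw
    have hne : v + w ≠ 0 := fun h0 => hvw (CharTwo.add_eq_zero.mp h0)
    have hv : v + w + v = w := by rw [add_right_comm, CharTwo.add_self_eq_zero, zero_add]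
    have hw : w + (v + w) = v := by rw [add_left_comm, CharTwo.add_self_eq_zero, add_zero]
    refine ⟨fun hs => ?_, fun hs => ?_⟩
    · have := h 0 (v + w) 1 v (fun h0 => hne h0.2)
        (by rw [hv, zero_add, ← hW, ← hW, hT, if_neg hne, hs, sub_zero])
      simp at this
    · have := h 1 w 0 (v + w) (by simp)
        (by rw [hw, add_zero, ← hW, ← hW, hT, if_neg hne, zero_add, hs])
      simp [hne] at this
  · intro h u v u' v' hn hs
    have h01 := (by decide : ∀ s : ZMod 2, s = 0 ∨ s = 1)
    have h11 : (1 + 1 : ZMod 2) = 0 := by decide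
    have hq : (2 : ℤ) ^ m ≠ 0 := by positivity
    rcases h01 u with rfl | rfl <;> rcases h01 u' with rfl | rfl <;>
      simp only [add_zero, zero_add, h11, ← hW, hT, CharTwo.add_eq_zero] at hs
    · have hv : v ≠ 0 := fun h0 => hn ⟨rfl, h0⟩
      by_contra! hcon
      rw [if_neg (hcon.1 rfl), if_neg (hcon.2 rfl).symm, if_neg hv] at hs
      exact hq (by simpa using hs.symm)
    · have hv : v ≠ 0 := fun h0 => hn ⟨rfl, h0⟩
      rw [if_neg hv, sub_zero] at hs
      exact absurd hs (h v' (v + v') (by simpa using hv)).1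
    · by_cases hv' : v' = 0
      · exact Or.inl ⟨rfl, hv'⟩
      · rw [if_neg hv', zero_add] at hs
        exact absurd hs (h (v + v') v (by simpa using hv')).2
    · by_cases hv : v = v'
      · exact Or.inr ⟨rfl, hv.symm⟩
      · rw [if_neg hv, add_zero] at hs
        exact absurd hs (h v' v (Ne.symm hv)).2
end

section
/- Let m ≥ 2 and let k be an integer with 1 ≤ k ≤ m−1. Let D = {α ∈ F_2^m : 1 ≤ wt(α) ≤ k} and D̄ = F_2^m \ (D ∪ {0}), and let C_{f_{D̄}} = {(u f_{D̄}(x) + ⟨v, x⟩)_{x ∈ F_2^m \ {0}} : u ∈ F_2, v ∈ F_2^m}. Then C_{f_{D̄}} has length 2^m − 1 and dimension m+1, and the multiset of Hamming weights of its codewords is: 0 with multiplicity 1; 2^{m−1} − Σ_{j=1}^k P_j(i) − 1 with multiplicity C(m,i) for each 1 ≤ i ≤ m; 2^{m−1} with multiplicity 2^m − 1; and 2^m − Σ_{j=1}^k C(m,j) − 1 with multiplicity 1. -/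
open Finset

/-- The nontrivial additive character of `ZMod 2`, with integer values. -/
def signChar (a : ZMod 2) : ℤ := if a = 0 then 1 else -1

@[simp] lemma signChar_zero : signChar 0 = 1 := rfl

@[simp] lemma signChar_one : signChar 1 = -1 := rfl

lemma signChar_add (a b : ZMod 2) : signChar (a + b) = signChar a * signChar b := by
  revert a b; decide

lemma signChar_sum {ι : Type*} (s : Finset ι) (f : ι → ZMod 2) :
    signChar (∑ i ∈ s, f i) = ∏ i ∈ s, signChar (f i) := by
  classical
  induction s using Finset.induction_on with
  | empty => simp
  | insert a s ha ih => rw [sum_insert ha, prod_insert ha, signChar_add, ih]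

open Polynomial in
/-- The coefficients of `(1 - X) ^ i * (1 + X) ^ n` in Krawtchouk form. -/
lemma coeff_one_sub_X_pow_mul_one_add_X_pow (i n j : ℕ) :
    ((1 - X : ℤ[X]) ^ i * (1 + X) ^ n).coeff j =
      ∑ l ∈ range (j + 1), (-1 : ℤ) ^ l * (i.choose l) * (n.choose (j - l)) := by
  have h (l : ℕ) : ((1 - X : ℤ[X]) ^ i).coeff l = (-1) ^ l * (i.choose l) := by
    have : (1 - X : ℤ[X]) ^ i = ((1 + X) ^ i).comp (C (-1) * X) := by simp [sub_eq_add_neg]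
    rw [this, comp_C_mul_X_coeff, coeff_one_add_X_pow, mul_comm]
  rw [coeff_mul, Nat.sum_antidiagonal_eq_sum_range_succ_mk]
  simp only [h, coeff_one_add_X_pow]

lemma prod_ite_eq_zero_eq_pow_hammingNorm {m : ℕ} {R : Type*} [CommRing R]
    (v : Fin m → ZMod 2) (a b : R) :
    ∏ i, (if v i = 0 then a else b) = b ^ hammingNorm v * a ^ (m - hammingNorm v) := by
  have h : #{i | v i = 0} = m - hammingNorm v := by
    have := card_filter_add_card_filter_not (s := (univ : Finset (Fin m))) (fun i => v i = 0)
    simp only [card_univ, Fintype.card_fin] at this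
    simp only [hammingNorm, ne_eq]
    omega
  rw [prod_ite, prod_const, prod_const, h, mul_comm]
  rfl

lemma sum_signChar_mul_pow_hammingNorm {m : ℕ} {R : Type*} [CommRing R]
    (v : Fin m → ZMod 2) (t : R) :
    ∑ x : Fin m → ZMod 2, (signChar (∑ i, v i * x i) : R) * t ^ hammingNorm x =
      (1 - t) ^ hammingNorm v * (1 + t) ^ (m - hammingNorm v) := by
  have key (x : Fin m → ZMod 2) :
      (signChar (∑ i, v i * x i) : R) * t ^ hammingNorm x =
        ∏ i, ((signChar (v i * x i) : R) * if x i = 0 then 1 else t) := by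
    rw [prod_mul_distrib, prod_ite_eq_zero_eq_pow_hammingNorm, signChar_sum]
    simp
  have two (g : ZMod 2 → R) : ∑ a, g a = g 0 + g 1 := Fin.sum_univ_two g
  simp only [key]
  rw [← Fintype.piFinset_univ,
    ← prod_univ_sum (fun _ => univ) (fun i a => (signChar (v i * a) : R) * if a = 0 then 1 else t),
    ← prod_ite_eq_zero_eq_pow_hammingNorm]
  refine prod_congr rfl fun i _ => ?_
  rw [two]
  generalize v i = a
  obtain rfl | rfl : a = 0 ∨ a = 1 := by revert a; decide
  · simp
  · simp [sub_eq_add_neg]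

/-- The Krawtchouk polynomials are the character sums over Hamming spheres. -/
lemma sum_signChar_sphere {m : ℕ} (v : Fin m → ZMod 2) (j : ℕ) :
    ∑ x : Fin m → ZMod 2 with hammingNorm x = j, signChar (∑ i, v i * x i) =
      ∑ l ∈ range (j + 1), (-1 : ℤ) ^ l * ((hammingNorm v).choose l) *
        ((m - hammingNorm v).choose (j - l)) := by
  rw [← coeff_one_sub_X_pow_mul_one_add_X_pow,
    ← sum_signChar_mul_pow_hammingNorm, Polynomial.finsetSum_coeff, sum_filter]
  refine sum_congr rfl fun x _ => ?_
  rw [← Polynomial.C_eq_intCast, Polynomial.coeff_C_mul_X_pow]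
  simp [eq_comm]

lemma card_hammingNorm_eq (m j : ℕ) :
    #{x : Fin m → ZMod 2 | hammingNorm x = j} = m.choose j := by
  have h := sum_signChar_sphere (0 : Fin m → ZMod 2) j
  rw [sum_range_succ'] at h
  simpa [Nat.choose_zero_succ] using h

lemma sum_signChar_eq_zero {m : ℕ} {v : Fin m → ZMod 2} (hv : v ≠ 0) :
    ∑ x : Fin m → ZMod 2, signChar (∑ i, v i * x i) = 0 := by
  have h := sum_signChar_mul_pow_hammingNorm v (1 : ℤ)
  simpa [hammingNorm_eq_zero, hv] using h

lemma sum_signChar_ball {m : ℕ} (v : Fin m → ZMod 2) (k : ℕ) :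
    ∑ x : Fin m → ZMod 2 with hammingNorm x ≤ k, signChar (∑ i, v i * x i) =
      1 + ∑ j ∈ Icc 1 k, ∑ l ∈ range (j + 1), (-1 : ℤ) ^ l * ((hammingNorm v).choose l) *
        ((m - hammingNorm v).choose (j - l)) := by
  have maps : ∀ x ∈ ({x | hammingNorm x ≤ k} : Finset (Fin m → ZMod 2)),
      hammingNorm x ∈ range (k + 1) := by
    intro x hx
    simpa [Nat.lt_succ_iff] using hx
  rw [← sum_fiberwise_of_maps_to maps, range_eq_Ico, sum_eq_sum_Ico_succ_bot (by omega)]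
  have sphere : ∀ j ≤ k, ∑ x ∈ ({x | hammingNorm x ≤ k} : Finset (Fin m → ZMod 2)) with
      hammingNorm x = j, signChar (∑ i, v i * x i) =
      ∑ l ∈ range (j + 1), (-1 : ℤ) ^ l * ((hammingNorm v).choose l) *
        ((m - hammingNorm v).choose (j - l)) := by
    intro j hj
    rw [← sum_signChar_sphere, filter_filter]
    refine sum_congr (filter_congr fun x _ => ?_) fun _ _ => rfl
    omega
  rw [sphere 0 (by omega)]
  congr 1
  · simp
  · exact sum_congr rfl fun j hj => sphere j (Nat.lt_succ_iff.1 (mem_Ico.1 hj).2)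

/-- The weight of the restriction to the nonzero vectors of a function vanishing at `0`. -/
lemma two_mul_hammingNorm_restrict {m : ℕ} (g : (Fin m → ZMod 2) → ZMod 2) (h0 : g 0 = 0) :
    2 * (hammingNorm (fun x : {x : Fin m → ZMod 2 // x ≠ 0} => g x.1) : ℤ) =
      2 ^ m - ∑ x, signChar (g x) := by
  have h1 : hammingNorm (fun x : {x : Fin m → ZMod 2 // x ≠ 0} => g x.1) = #{x | g x ≠ 0} := by
    unfold hammingNorm
    refine card_bij (fun x _ => x.1) (by simp) (fun _ _ _ _ h => Subtype.ext h) fun x hx => ?_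
    have hx : g x ≠ 0 := by simpa using hx
    exact ⟨⟨x, fun h => hx (h ▸ h0)⟩, by simpa using hx, rfl⟩
  have h2 (a : ZMod 2) : signChar a = 1 - 2 * if a ≠ 0 then 1 else 0 := by
    revert a; decide
  simp only [h1, h2, sum_sub_distrib, ← mul_sum, sum_boole]
  simp

lemma hammingNorm_linear {m : ℕ} (hm : 1 ≤ m) {v : Fin m → ZMod 2} (hv : v ≠ 0) :
    (hammingNorm (fun x : {x : Fin m → ZMod 2 // x ≠ 0} => ∑ i, v i * x.1 i) : ℤ) =
      2 ^ (m - 1) := by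
  have h := two_mul_hammingNorm_restrict (fun x => ∑ i, v i * x i) (by simp)
  rw [sum_signChar_eq_zero hv] at h
  obtain ⟨n, rfl⟩ := Nat.exists_eq_add_of_le' hm
  rw [pow_succ] at h
  simp only [Nat.add_sub_cancel]
  linarith

lemma two_mul_hammingNorm_add_linear {m k : ℕ} (v : Fin m → ZMod 2) :
    2 * (hammingNorm (fun x : {x : Fin m → ZMod 2 // x ≠ 0} =>
      (if k < hammingNorm x.1 then 1 else 0) + ∑ i, v i * x.1 i) : ℤ) =
      2 ^ m + ∑ x : Fin m → ZMod 2, signChar (∑ i, v i * x i) -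
        2 * (1 + ∑ j ∈ Icc 1 k, ∑ l ∈ range (j + 1), (-1 : ℤ) ^ l *
          ((hammingNorm v).choose l) * ((m - hammingNorm v).choose (j - l))) := by
  rw [two_mul_hammingNorm_restrict
    (fun x => (if k < hammingNorm x then 1 else 0) + ∑ i, v i * x i) (by simp),
    ← sum_signChar_ball, sum_filter, mul_sum, add_sub_assoc, ← sum_sub_distrib,
    sub_eq_add_neg, ← sum_neg_distrib]
  congr 1
  refine sum_congr rfl fun x _ => ?_
  rw [signChar_add]
  by_cases h : k < hammingNorm x
  · simp [h, not_le.2 h]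
  · rw [if_neg h, if_pos (not_lt.1 h), signChar_zero]
    ring

lemma sum_ne_zero_singleton_hammingNorm {α : Type*} (m : ℕ) (g : ℕ → α) :
    ∑ v : Fin m → ZMod 2 with v ≠ 0, ({g (hammingNorm v)} : Multiset α) =
      ∑ i ∈ Icc 1 m, Multiset.replicate (m.choose i) (g i) := by
  have maps : ∀ v ∈ ({v | v ≠ 0} : Finset (Fin m → ZMod 2)), hammingNorm v ∈ Icc 1 m := by
    intro v hv
    have h1 : v ≠ 0 := by simpa using hv
    have h2 := hammingNorm_le_card_fintype (x := v)
    rw [Fintype.card_fin] at h2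
    exact mem_Icc.2 ⟨hammingNorm_pos_iff.2 h1, h2⟩
  rw [← sum_fiberwise_of_maps_to maps]
  refine sum_congr rfl fun i hi => ?_
  have hi := mem_Icc.1 hi
  rw [filter_filter, filter_congr (q := fun v => hammingNorm v = i), ← card_hammingNorm_eq m i,
    sum_congr rfl (g := fun _ => {g i}), sum_const, Multiset.nsmul_singleton]
  · intro v hv
    rw [(mem_filter.1 hv).2]
  · intro v _
    refine ⟨And.right, fun h => ⟨?_, h⟩⟩
    rintro rfl
    simp at h
    omega

/-- Let `m ≥ 2`, `1 ≤ k ≤ m − 1`, `D = {α ∈ F_2^m : 1 ≤ wt(α) ≤ k}` and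
`D̄ = F_2^m \ (D ∪ {0})`. Then `C_{f_{D̄}}` has length `2^m − 1`, dimension `m + 1`, and its
weight multiset is: `0` (×1); `2^{m−1} − Σ_{j=1}^k P_j(i) − 1` (×`C(m,i)`) for `1 ≤ i ≤ m`;
`2^{m−1}` (×`2^m − 1`); and `2^m − Σ_{j=1}^k C(m,j) − 1` (×1), where `P_j` are the
Krawtchouk polynomials. -/
theorem complement_ball_code_weight_distribution
    {m k : ℕ} (hm : 2 ≤ m) (hk1 : 1 ≤ k) (hk2 : k ≤ m - 1) :
    let V := Fin m → ZMod 2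
    -- the standard inner product on `V`
    let ip : V → V → ZMod 2 := fun a b => ∑ i, a i * b i
    -- the characteristic function of `D̄ = F_2^m \ (D ∪ {0})`, `D = {α : 1 ≤ wt(α) ≤ k}`
    let fDbar : V → ZMod 2 := fun z =>
      if z ≠ 0 ∧ ¬(1 ≤ hammingNorm z ∧ hammingNorm z ≤ k) then 1 else 0
    -- the codewords of `C_{f_{D̄}}`, indexed by the nonzero elements of `V`
    let c : ZMod 2 × V → ({x : V // x ≠ 0} → ZMod 2) :=
      fun uv x => uv.1 * fDbar x.1 + ip uv.2 x.1
    -- the Krawtchouk polynomial `P_j(i)` for parameter `m`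
    let P : ℕ → ℕ → ℤ := fun j i =>
      ∑ l ∈ Finset.range (j + 1), (-1 : ℤ) ^ l * (i.choose l) * ((m - i).choose (j - l))
    -- length `2^m − 1`
    (Fintype.card {x : V // x ≠ 0} = 2 ^ m - 1) ∧
    -- dimension `m + 1`
    (Module.finrank (ZMod 2) (Submodule.span (ZMod 2) (Set.range c)) = m + 1) ∧
    -- weight distribution
    (Multiset.map (fun uv => (hammingNorm (c uv) : ℤ)) (Finset.univ : Finset (ZMod 2 × V)).val =
      {0} +
      (∑ i ∈ Finset.Icc 1 m, Multiset.replicate (m.choose i)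
        ((2 ^ (m - 1) : ℤ) - (∑ j ∈ Finset.Icc 1 k, P j i) - 1)) +
      Multiset.replicate (2 ^ m - 1) ((2 ^ (m - 1) : ℤ)) +
      {(2 ^ m : ℤ) - (∑ j ∈ Finset.Icc 1 k, (m.choose j : ℤ)) - 1}) := by
  intro V
  subst V
  intro ip fDbar c P
  have card_nonzero : Fintype.card {x : Fin m → ZMod 2 // x ≠ 0} = 2 ^ m - 1 := by
    rw [Fintype.card_subtype_compl, Fintype.card_subtype_eq]
    simp [ZMod.card]
  have fDbar_eq (z : Fin m → ZMod 2) : fDbar z = if k < hammingNorm z then 1 else 0 := by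
    refine if_congr ⟨fun ⟨h, h'⟩ => ?_, fun h => ⟨?_, by omega⟩⟩ rfl rfl
    · have := hammingNorm_pos_iff.2 h
      omega
    · exact hammingNorm_pos_iff.1 (by omega)
  refine ⟨card_nonzero, ?_, ?_⟩
  · let L : ZMod 2 × (Fin m → ZMod 2) →ₗ[ZMod 2] ({x : Fin m → ZMod 2 // x ≠ 0} → ZMod 2) :=
      { toFun := c
        map_add' := fun a b => by
          funext x
          simp only [c, ip, Prod.fst_add, Prod.snd_add, Pi.add_apply, add_mul, sum_add_distrib]
          ring
        map_smul' := fun r a => by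
          funext x
          simp only [c, ip, Prod.smul_fst, Prod.smul_snd, Pi.smul_apply, smul_eq_mul, mul_add,
            mul_sum, RingHom.id_apply, mul_assoc] }
    have inj : Function.Injective L := by
      rw [← LinearMap.ker_eq_bot, LinearMap.ker_eq_bot']
      rintro ⟨u, v⟩ h
      have ev (x : Fin m → ZMod 2) (hx : x ≠ 0) : u * fDbar x + ip v x = 0 := congrFun h ⟨x, hx⟩
      have hv : v = 0 := by
        funext i
        have hs : hammingNorm (Pi.single i 1 : Fin m → ZMod 2) ≤ 1 := by
          unfold hammingNorm
          refine card_le_one.2 fun a ha b hb => ?_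
          simp only [mem_filter, mem_univ, true_and, Pi.single_apply] at ha hb
          rw [(ite_ne_right_iff.1 ha).1, (ite_ne_right_iff.1 hb).1]
        have := ev (Pi.single i 1) (by simp)
        rw [fDbar_eq, if_neg (by omega)] at this
        simpa [ip, Pi.single_apply] using this
      have hone : hammingNorm (1 : Fin m → ZMod 2) = m := by simp [hammingNorm]
      have hu := ev 1 (fun h0 => by rw [h0, hammingNorm_zero] at hone; omega)
      rw [fDbar_eq, if_pos (by omega), hv] at hu
      have hu : u = 0 := by simpa [ip] using hu
      rw [hu, hv]
      rfl
    have hc : Set.range c = (LinearMap.range L : Set _) := rfl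
    rw [hc, Submodule.span_eq, LinearMap.finrank_range_of_inj inj]
    simp [add_comm]
  · have weight_zero_zero : (hammingNorm (c (0, 0)) : ℤ) = 0 := by
      have : c (0, 0) = 0 := by funext x; simp [c, ip]
      simp [this]
    have weight_zero (v : Fin m → ZMod 2) (hv : v ≠ 0) : (hammingNorm (c (0, v)) : ℤ) = 2 ^ (m - 1) := by
      rw [← hammingNorm_linear (by omega) hv]
      simp [c, ip]
    have weight_one (v : Fin m → ZMod 2) := two_mul_hammingNorm_add_linear (k := k) v
    have c_one (v : Fin m → ZMod 2) : c (1, v) = fun x : {x : Fin m → ZMod 2 // x ≠ 0} =>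
        (if k < hammingNorm x.1 then 1 else 0) + ∑ i, v i * x.1 i := by
      funext x
      simp only [c, ip, fDbar_eq, one_mul]
    have weight_one_ne (v : Fin m → ZMod 2) (hv : v ≠ 0) : (hammingNorm (c (1, v)) : ℤ) =
        2 ^ (m - 1) - (∑ j ∈ Icc 1 k, P j (hammingNorm v)) - 1 := by
      have h := weight_one v
      rw [← c_one, sum_signChar_eq_zero hv] at h
      have hp : (2 : ℤ) ^ m = 2 * 2 ^ (m - 1) := by rw [← pow_succ', Nat.sub_add_cancel (by omega)]
      simp only [P]
      linarith
    have weight_one_zero : (hammingNorm (c (1, 0)) : ℤ) =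
        2 ^ m - (∑ j ∈ Icc 1 k, (m.choose j : ℤ)) - 1 := by
      have h := weight_one 0
      have hP : ∀ j, ∑ l ∈ range (j + 1), (-1 : ℤ) ^ l * ((hammingNorm (0 : Fin m → ZMod 2)).choose l) *
          ((m - hammingNorm (0 : Fin m → ZMod 2)).choose (j - l)) = m.choose j := fun j => by
        rw [← sum_signChar_sphere, ← card_hammingNorm_eq]
        simp
      rw [← c_one, sum_congr rfl fun j _ => hP j] at h
      simp at h
      linarith
    have two (g : ZMod 2 → Multiset ℤ) : ∑ a, g a = g 0 + g 1 := Fin.sum_univ_two g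
    have split (g : (Fin m → ZMod 2) → Multiset ℤ) : ∑ v, g v = g 0 + ∑ v with v ≠ 0, g v := by
      rw [filter_ne', add_sum_erase _ _ (mem_univ _)]
    have card_ne : #{v : Fin m → ZMod 2 | v ≠ 0} = 2 ^ m - 1 := by rw [← card_nonzero, Fintype.card_subtype]
    have sum_weight_one : ∑ v : Fin m → ZMod 2 with v ≠ 0,
        ({(hammingNorm (c (1, v)) : ℤ)} : Multiset ℤ) = ∑ i ∈ Icc 1 m, Multiset.replicate
          (m.choose i) ((2 ^ (m - 1) : ℤ) - (∑ j ∈ Icc 1 k, P j i) - 1) := by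
      rw [← sum_ne_zero_singleton_hammingNorm m fun i => _ - (∑ j ∈ Icc 1 k, P j i) - 1]
      exact sum_congr rfl fun v hv => by rw [weight_one_ne v (mem_filter.1 hv).2]
    rw [← Multiset.sum_map_singleton (Multiset.map _ _), Multiset.map_map]
    change ∑ uv : ZMod 2 × (Fin m → ZMod 2), ({(hammingNorm (c uv) : ℤ)} : Multiset ℤ) = _
    rw [Fintype.sum_prod_type, two, split, split, weight_zero_zero, weight_one_zero,
      sum_congr rfl (g := fun _ => {2 ^ (m - 1)}), sum_const, card_ne, Multiset.nsmul_singleton,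
      sum_weight_one]
    · abel
    · intro v hv
      rw [weight_zero v (mem_filter.1 hv).2]
end

section
/- Let p be a prime and let E_1, E_2 be F_p-subspaces of F_q with dim(E_1) = t_1, dim(E_2) = t_2, t_1 + t_2 = m, 2 ≤ t_1 < t_2 ≤ m−2, E_1 ∩ E_2 = {0}, and E_1^⊥ ∩ E_2^⊥ = {0}. Let D = (E_1 ∪ E_2) \ {0} and D̄ = F_q^* \ D. Then C_{f_D} and C_{f_{D̄}} are [p^m − 1, m+1] minimal linear codes over F_p satisfying w_min/w_max ≤ (p−1)/p, where w_min and w_max denote the minimum and maximum nonzero Hamming weights in the respective code. -/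
open Finset

section LinearAlgebra

variable {K V : Type*} [Field K] [AddCommGroup V] [Module K V]

theorem exists_ne_zero_mem_of_two_le_finrank [FiniteDimensional K V] {E : Submodule K V}
    (hE : 2 ≤ Module.finrank K E) (l : Module.Dual K V) : ∃ x ∈ E, x ≠ 0 ∧ l x = 0 := by
  have h := LinearMap.ker_ne_bot_of_finrank_lt (f := l.domRestrict E)
    (by rw [Module.finrank_self]; omega)
  obtain ⟨x, hx, hx0⟩ := Submodule.exists_mem_ne_zero_of_ne_bot h
  exact ⟨x, x.2, by simpa using hx0, by simpa using hx⟩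

theorem exists_ne_zero_mem_of_three_le_finrank [FiniteDimensional K V] {E : Submodule K V}
    (hE : 3 ≤ Module.finrank K E) (l l' : Module.Dual K V) :
    ∃ x ∈ E, x ≠ 0 ∧ l x = 0 ∧ l' x = 0 := by
  have h := LinearMap.ker_ne_bot_of_finrank_lt (f := (l.prod l').domRestrict E)
    (by rw [Module.finrank_prod, Module.finrank_self]; omega)
  obtain ⟨x, hx, hx0⟩ := Submodule.exists_mem_ne_zero_of_ne_bot h
  have hx' : l x = 0 ∧ l' x = 0 := by simpa using hx
  exact ⟨x, x.2, by simpa using hx0, hx'⟩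

/-- A hyperplane of `E` that misses the origin spans `E`. -/
theorem eq_zero_of_eq_zero_on_affine_hyperplane {E : Submodule K V} {l L : Module.Dual K V} {u : K}
    (hu : u ≠ 0) (hl : ∃ x ∈ E, l x ≠ 0) (hL : ∀ x ∈ E, l x = u → L x = 0) :
    ∀ x ∈ E, L x = 0 := by
  have hne : ∀ x ∈ E, l x ≠ 0 → L x = 0 := by
    intro x hx hlx
    have h := hL ((u / l x) • x) (E.smul_mem _ hx) (by simp [hlx])
    simpa [hu, hlx] using h
  obtain ⟨z, hz, hlz⟩ := hl
  intro x hx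
  by_cases hlx : l x = 0
  · have h := hne (x + z) (E.add_mem hx hz) (by simpa [hlx] using hlz)
    simpa [hne z hz hlz] using h
  · exact hne x hx hlx

theorem exists_eq_smul_of_ker_le_ker {l l' : Module.Dual K V} (h : ∀ x, l x = 0 → l' x = 0) :
    ∃ k : K, l' = k • l := by
  have hs := mem_span_of_iInf_ker_le_ker (L := fun _ : Unit => l) (K := l')
    (by intro x hx; simpa using h x (by simpa using hx))
  rw [Set.range_const, Submodule.mem_span_singleton] at hs
  obtain ⟨k, hk⟩ := hs
  exact ⟨k, hk.symm⟩

end LinearAlgebra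

section CharacteristicCode

variable {K V : Type*} [Field K] [AddCommGroup V] [Module K V]

/-- The encoder `(u, l) ↦ (u f(x) - l(x))_{x ≠ 0}` attached to a function `f : V → K`. -/
def functionEncoder (f : V → K) : K × Module.Dual K V →ₗ[K] ({x : V // x ≠ 0} → K) where
  toFun ul x := ul.1 * f x.1 - ul.2 x.1
  map_add' a b := by ext x; simp; ring
  map_smul' c a := by ext x; simp; ring

@[simp]
theorem functionEncoder_apply (f : V → K) (u : K) (l : Module.Dual K V) (x : {x : V // x ≠ 0}) :
    functionEncoder f (u, l) x = u * f x.1 - l x.1 := rfl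

/-- The zeros of a codeword `(0, l)` force `u' = 0` in every codeword `(u', l')` they kill. -/
def LinearWordsSeparate (f : V → K) : Prop :=
  ∀ (l l' : Module.Dual K V) (u' : K), (∀ x, x ≠ 0 → l x = 0 → u' * f x = l' x) → u' = 0

/-- The zeros of a codeword `(u, l)` with `u ≠ 0` span the whole space. -/
def NonlinearZerosSpan (f : V → K) : Prop :=
  ∀ (l L : Module.Dual K V) (u : K), u ≠ 0 → (∀ x, x ≠ 0 → u * f x = l x → L x = 0) → L = 0

theorem functionEncoder_injective {f : V → K} (h : LinearWordsSeparate f) :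
    Function.Injective (functionEncoder f) := by
  rw [← LinearMap.ker_eq_bot, LinearMap.ker_eq_bot']
  rintro ⟨u, l⟩ hul
  have hx : ∀ x, x ≠ 0 → u * f x = l x := fun x hx =>
    sub_eq_zero.mp (congrFun hul ⟨x, hx⟩)
  have hu : u = 0 := h 0 l u fun x h0 _ => hx x h0
  subst hu
  refine Prod.ext rfl (LinearMap.ext fun x => ?_)
  by_cases h0 : x = 0
  · simp [h0]
  · simpa using (hx x h0).symm

theorem functionEncoder_minimal {f : V → K} (h : LinearWordsSeparate f)
    (h' : NonlinearZerosSpan f) {a b : K × Module.Dual K V}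
    (hab : ∀ i, functionEncoder f b i ≠ 0 → functionEncoder f a i ≠ 0) :
    ∃ k : K, functionEncoder f b = k • functionEncoder f a := by
  obtain ⟨u, l⟩ := a
  obtain ⟨u', l'⟩ := b
  have hz : ∀ x, x ≠ 0 → u * f x = l x → u' * f x = l' x := by
    intro x hx hxa
    by_contra hne
    exact hab ⟨x, hx⟩ (sub_ne_zero.mpr hne) (sub_eq_zero.mpr hxa)
  suffices ∃ k : K, (u', l') = k • (u, l) by
    obtain ⟨k, hk⟩ := this
    exact ⟨k, by rw [hk, map_smul]⟩
  by_cases hu : u = 0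
  · subst hu
    have hu' : u' = 0 := h l l' u' fun x hx hlx => hz x hx (by simp [hlx])
    subst hu'
    obtain ⟨k, hk⟩ := exists_eq_smul_of_ker_le_ker (l := l) (l' := l') (by
      intro x hlx
      by_cases hx : x = 0
      · simp [hx]
      · simpa using (hz x hx (by simp [hlx])).symm)
    exact ⟨k, by simp [hk]⟩
  · have hL := h' l (l' - (u' / u) • l) u hu (by
      intro x hx hxa
      have hxb := hz x hx hxa
      simp only [LinearMap.sub_apply, LinearMap.smul_apply, smul_eq_mul, ← hxa, ← hxb]
      field_simp
      ring)
    exact ⟨u' / u, Prod.ext (by simp [hu]) (sub_eq_zero.mp hL)⟩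

theorem hammingNorm_functionEncoder [DecidableEq K] [Fintype {x : V // x ≠ 0}]
    {f : V → K} (hf : f 0 = 0) {W : Type*} (e : W ≃ V) (u : K) (l : Module.Dual K V) :
    hammingNorm (functionEncoder f (u, l)) = {w : W | u * f (e w) ≠ l (e w)}.ncard := by
  rw [hammingNorm, ← Set.ncard_coe_finset]
  refine Set.ncard_congr (fun x _ => e.symm x.1) ?_ ?_ ?_
  · intro x hx
    simpa [sub_eq_zero] using hx
  · intro x y _ _ hxy
    exact Subtype.ext (e.symm.injective hxy)
  · intro w hw
    refine ⟨⟨e w, fun h0 => hw (by simp [h0, hf])⟩, ?_, by simp⟩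
    simpa [sub_eq_zero] using hw

end CharacteristicCode

section TwoSubspaces

variable {K V : Type*} [Field K] [AddCommGroup V] [Module K V] {E₁ E₂ : Submodule K V}

theorem add_mem_left_or_right_iff (hE : Disjoint E₁ E₂) {x y : V} (hx : x ∈ E₁) (hy : y ∈ E₂) :
    (x + y ∈ E₁ ∨ x + y ∈ E₂) ↔ (x = 0 ∨ y = 0) := by
  rw [E₁.add_mem_iff_right hx, E₂.add_mem_iff_left hy]
  constructor
  · rintro (h | h)
    · exact Or.inr (Submodule.disjoint_def.mp hE y h hy)
    · exact Or.inl (Submodule.disjoint_def.mp hE x hx h)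
  · rintro (rfl | rfl)
    · exact Or.inr E₂.zero_mem
    · exact Or.inl E₁.zero_mem

theorem add_notMem_left_or_right (hE : Disjoint E₁ E₂) {x y : V} (hx : x ∈ E₁) (hy : y ∈ E₂)
    (hx0 : x ≠ 0) (hy0 : y ≠ 0) : ¬(x + y ∈ E₁ ∨ x + y ∈ E₂) := by
  rw [add_mem_left_or_right_iff hE hx hy]
  tauto

theorem ne_zero_of_notMem_left_or_right {x : V} (hx : ¬(x ∈ E₁ ∨ x ∈ E₂)) : x ≠ 0 := by
  rintro rfl
  exact hx (Or.inl E₁.zero_mem)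

theorem dual_eq_zero_of_isCompl (hE : IsCompl E₁ E₂) {L : Module.Dual K V}
    (h₁ : ∀ x ∈ E₁, L x = 0) (h₂ : ∀ x ∈ E₂, L x = 0) : L = 0 := by
  ext z
  obtain ⟨x, hx, y, hy, rfl⟩ := Submodule.mem_sup.mp (hE.sup_eq_top ▸ Submodule.mem_top (x := z))
  simp [h₁ x hx, h₂ y hy]

variable [FiniteDimensional K V] {f : V → K}

theorem linearWordsSeparate_of_union (hd : 3 ≤ Module.finrank K E₂)
    (hf : ∀ x, x ≠ 0 → (x ∈ E₁ ∨ x ∈ E₂) → f x = 1) : LinearWordsSeparate f := by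
  intro l l' u' h
  obtain ⟨x, hx, hx0, hl, hl'⟩ := exists_ne_zero_mem_of_three_le_finrank hd l l'
  simpa [hf x hx0 (Or.inr hx), hl'] using h x hx0 hl

theorem linearWordsSeparate_of_compl (hE : Disjoint E₁ E₂)
    (hd₁ : 2 ≤ Module.finrank K E₁) (hd₂ : 2 ≤ Module.finrank K E₂)
    (hf : ∀ x, (x ∈ E₁ ∨ x ∈ E₂) → f x = 0) (hf' : ∀ x, ¬(x ∈ E₁ ∨ x ∈ E₂) → f x = 1) :
    LinearWordsSeparate f := by
  intro l l' u' h
  obtain ⟨x, hx, hx0, hlx⟩ := exists_ne_zero_mem_of_two_le_finrank hd₁ l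
  obtain ⟨y, hy, hy0, hly⟩ := exists_ne_zero_mem_of_two_le_finrank hd₂ l
  have hxy := add_notMem_left_or_right hE hx hy hx0 hy0
  have hl'x := h x hx0 hlx
  have hl'y := h y hy0 hly
  have hl'xy := h (x + y) (ne_zero_of_notMem_left_or_right hxy) (by simp [hlx, hly])
  rw [hf x (Or.inl hx), mul_zero] at hl'x
  rw [hf y (Or.inr hy), mul_zero] at hl'y
  simpa [hf' _ hxy, ← hl'x, ← hl'y] using hl'xy

theorem eq_zero_on_left_of_union (hE : Disjoint E₁ E₂) (hd₂ : 2 ≤ Module.finrank K E₂)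
    (hf : ∀ x, x ≠ 0 → (x ∈ E₁ ∨ x ∈ E₂) → f x = 1) (hf' : ∀ x, ¬(x ∈ E₁ ∨ x ∈ E₂) → f x = 0)
    {l L : Module.Dual K V} {u : K} (hu : u ≠ 0)
    (h : ∀ x, x ≠ 0 → u * f x = l x → L x = 0) : ∀ x ∈ E₁, L x = 0 := by
  have hin : ∀ x, (x ∈ E₁ ∨ x ∈ E₂) → l x = u → L x = 0 := by
    intro x hx hlx
    have hx0 : x ≠ 0 := by
      rintro rfl
      exact hu (by simpa using hlx.symm)
    exact h x hx0 (by rw [hf x hx0 hx, hlx, mul_one])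
  by_cases hl₁ : ∃ x ∈ E₁, l x ≠ 0
  · exact eq_zero_of_eq_zero_on_affine_hyperplane hu hl₁ fun x hx => hin x (Or.inl hx)
  · push Not at hl₁
    obtain ⟨y, hy, hy0, hly, hLy⟩ : ∃ y ∈ E₂, y ≠ 0 ∧ l y = 0 ∧ L y = 0 := by
      by_cases hl₂ : ∃ y ∈ E₂, l y ≠ 0
      · have hL := eq_zero_of_eq_zero_on_affine_hyperplane hu hl₂ fun x hx => hin x (Or.inr hx)
        obtain ⟨y, hy, hy0, hly⟩ := exists_ne_zero_mem_of_two_le_finrank hd₂ l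
        exact ⟨y, hy, hy0, hly, hL y hy⟩
      · push Not at hl₂
        obtain ⟨y, hy, hy0, hLy⟩ := exists_ne_zero_mem_of_two_le_finrank hd₂ L
        exact ⟨y, hy, hy0, hl₂ y hy, hLy⟩
    intro x hx
    by_cases hx0 : x = 0
    · simp [hx0]
    · have hxy := add_notMem_left_or_right hE hx hy hx0 hy0
      have hL := h (x + y) (ne_zero_of_notMem_left_or_right hxy)
        (by simp [hf' _ hxy, hl₁ x hx, hly])
      simpa [hLy] using hL

theorem eq_zero_on_left_of_compl (hE : Disjoint E₁ E₂) (hd₂ : 2 ≤ Module.finrank K E₂)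
    (hf : ∀ x, (x ∈ E₁ ∨ x ∈ E₂) → f x = 0) (hf' : ∀ x, ¬(x ∈ E₁ ∨ x ∈ E₂) → f x = 1)
    {l L : Module.Dual K V} {u : K} (hu : u ≠ 0)
    (h : ∀ x, x ≠ 0 → u * f x = l x → L x = 0) : ∀ x ∈ E₁, L x = 0 := by
  have hin : ∀ x, (x ∈ E₁ ∨ x ∈ E₂) → x ≠ 0 → l x = 0 → L x = 0 := fun x hx hx0 hlx =>
    h x hx0 (by rw [hf x hx, hlx, mul_zero])
  by_cases hl₁ : ∃ x ∈ E₁, l x ≠ 0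
  · obtain ⟨y, hy, hy0, hly⟩ := exists_ne_zero_mem_of_two_le_finrank hd₂ l
    refine eq_zero_of_eq_zero_on_affine_hyperplane hu hl₁ fun x hx hlx => ?_
    have hx0 : x ≠ 0 := by
      rintro rfl
      exact hu (by simpa using hlx.symm)
    have hxy := add_notMem_left_or_right hE hx hy hx0 hy0
    have hL := h (x + y) (ne_zero_of_notMem_left_or_right hxy) (by simp [hf' _ hxy, hlx, hly])
    simpa [hin y (Or.inr hy) hy0 hly] using hL
  · push Not at hl₁
    intro x hx
    by_cases hx0 : x = 0
    · simp [hx0]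
    · exact hin x (Or.inl hx) hx0 (hl₁ x hx)

theorem nonlinearZerosSpan_of_union (hE : IsCompl E₁ E₂)
    (hd₁ : 2 ≤ Module.finrank K E₁) (hd₂ : 2 ≤ Module.finrank K E₂)
    (hf : ∀ x, x ≠ 0 → (x ∈ E₁ ∨ x ∈ E₂) → f x = 1) (hf' : ∀ x, ¬(x ∈ E₁ ∨ x ∈ E₂) → f x = 0) :
    NonlinearZerosSpan f := fun _ _ _ hu h =>
  dual_eq_zero_of_isCompl hE (eq_zero_on_left_of_union hE.disjoint hd₂ hf hf' hu h)
    (eq_zero_on_left_of_union hE.symm.disjoint hd₁ (fun x hx0 hx => hf x hx0 hx.symm)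
      (fun x hx => hf' x (mt Or.symm hx)) hu h)

theorem nonlinearZerosSpan_of_compl (hE : IsCompl E₁ E₂)
    (hd₁ : 2 ≤ Module.finrank K E₁) (hd₂ : 2 ≤ Module.finrank K E₂)
    (hf : ∀ x, (x ∈ E₁ ∨ x ∈ E₂) → f x = 0) (hf' : ∀ x, ¬(x ∈ E₁ ∨ x ∈ E₂) → f x = 1) :
    NonlinearZerosSpan f := fun _ _ _ hu h =>
  dual_eq_zero_of_isCompl hE (eq_zero_on_left_of_compl hE.disjoint hd₂ hf hf' hu h)
    (eq_zero_on_left_of_compl hE.symm.disjoint hd₁ (fun x hx => hf x hx.symm)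
      (fun x hx => hf' x (mt Or.symm hx)) hu h)

end TwoSubspaces

section Counting

variable {K A : Type*} [Field K] [AddCommGroup A] [Module K A] [FiniteDimensional K A]

theorem ncard_dual_eq_zero {a : Module.Dual K A} (ha : a ≠ 0) :
    {x | a x = 0}.ncard = Nat.card K ^ (Module.finrank K A - 1) := by
  have h := Module.natCard_eq_pow_finrank (K := K) (V := LinearMap.ker a)
  have hr := Module.Dual.finrank_ker_add_one_of_ne_zero ha
  rw [← Nat.card_coe_set_eq, show Module.finrank K A - 1 = Module.finrank K (LinearMap.ker a) by
    omega, ← h]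
  rfl

theorem ncard_dual_eq_one {a : Module.Dual K A} (ha : a ≠ 0) :
    {x | a x = 1}.ncard = Nat.card K ^ (Module.finrank K A - 1) := by
  obtain ⟨z, hz⟩ := LinearMap.surjective ha 1
  rw [← ncard_dual_eq_zero ha]
  refine Set.ncard_congr (fun x _ => x - z) ?_ ?_ ?_
  · intro x hx
    simp_all
  · intro x y _ _ hxy
    simpa using hxy
  · intro x hx
    exact ⟨x + z, by simp_all, by simp⟩

theorem ncard_dual_ne_zero [Finite A] {a : Module.Dual K A} (ha : a ≠ 0) :
    {x | a x ≠ 0}.ncard = Nat.card A - Nat.card K ^ (Module.finrank K A - 1) := by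
  rw [← ncard_dual_eq_zero ha, ← Set.ncard_compl]
  rfl

theorem ncard_ne_zero_and_dual_ne_one [Finite A] {a : Module.Dual K A} (ha : a ≠ 0) :
    {x | x ≠ 0 ∧ a x ≠ 1}.ncard =
      Nat.card A - (Nat.card K ^ (Module.finrank K A - 1) + 1) := by
  have h : {x | x ≠ 0 ∧ a x ≠ 1} = (insert 0 {x | a x = 1})ᶜ := by
    ext x
    simp
  rw [h, Set.ncard_compl, Set.ncard_insert_of_notMem (by simp), ncard_dual_eq_one ha]

theorem ncard_compl_zero {A : Type*} [Zero A] [Finite A] : ({0}ᶜ : Set A).ncard = Nat.card A - 1 := by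
  rw [Set.ncard_compl, Set.ncard_singleton]

end Counting

section Weights

variable {K V : Type*} [Field K] [AddCommGroup V] [Module K V]
  {E₁ E₂ : Submodule K V} {f : V → K}

theorem zero_or_zero_of_prod (hE : IsCompl E₁ E₂) (w : E₁ × E₂) :
    ((E₁.prodEquivOfIsCompl E₂ hE w ∈ E₁ ∨ E₁.prodEquivOfIsCompl E₂ hE w ∈ E₂) ↔
      (w.1 = 0 ∨ w.2 = 0)) := by
  rw [Submodule.coe_prodEquivOfIsCompl',
    add_mem_left_or_right_iff hE.disjoint w.1.2 w.2.2]
  simp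

/-- The functional on `E₁ ⊕ E₂` extending `a` by zero on `E₂`. -/
noncomputable def extendLeft (hE : IsCompl E₁ E₂) (a : Module.Dual K E₁) : Module.Dual K V :=
  a ∘ₗ LinearMap.fst K E₁ E₂ ∘ₗ (E₁.prodEquivOfIsCompl E₂ hE).symm.toLinearMap

theorem extendLeft_apply (hE : IsCompl E₁ E₂) (a : Module.Dual K E₁) (w : E₁ × E₂) :
    extendLeft hE a (E₁.prodEquivOfIsCompl E₂ hE w) = a w.1 := by
  simp [extendLeft]

variable [Finite V] [DecidableEq K] [Fintype {x : V // x ≠ 0}]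

theorem hammingNorm_union_le (hE : IsCompl E₁ E₂) (hf0 : f 0 = 0)
    (hf' : ∀ x, ¬(x ∈ E₁ ∨ x ∈ E₂) → f x = 0) :
    hammingNorm (functionEncoder f (1, 0)) ≤ (Nat.card E₁ - 1) + (Nat.card E₂ - 1) := by
  rw [hammingNorm_functionEncoder hf0 (E₁.prodEquivOfIsCompl E₂ hE).toEquiv]
  calc _ ≤ (({0}ᶜ : Set E₁) ×ˢ ({0} : Set E₂) ∪ ({0} : Set E₁) ×ˢ ({0}ᶜ : Set E₂)).ncard := by
        refine Set.ncard_le_ncard (fun w hw => ?_)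
        have h := zero_or_zero_of_prod hE w
        have h' := hf' (E₁.prodEquivOfIsCompl E₂ hE w)
        have hw0 : w.1 = 0 → w.2 = 0 → False := by
          intro h1 h2
          exact hw (by simp [show w = 0 from Prod.ext h1 h2, hf0])
        simp at hw ⊢
        tauto
    _ ≤ _ := by
        refine (Set.ncard_union_le _ _).trans ?_
        simp only [Set.ncard_prod, ncard_compl_zero, Set.ncard_singleton, mul_one, one_mul, le_refl]

theorem le_hammingNorm_compl (hE : IsCompl E₁ E₂)
    (hf0 : f 0 = 0) (hf' : ∀ x, ¬(x ∈ E₁ ∨ x ∈ E₂) → f x = 1) :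
    (Nat.card E₁ - 1) * (Nat.card E₂ - 1) ≤ hammingNorm (functionEncoder f (1, 0)) := by
  rw [hammingNorm_functionEncoder hf0 (E₁.prodEquivOfIsCompl E₂ hE).toEquiv]
  calc _ = (({0}ᶜ : Set E₁) ×ˢ ({0}ᶜ : Set E₂)).ncard := by
        simp only [Set.ncard_prod, ncard_compl_zero]
    _ ≤ _ := by
        refine Set.ncard_le_ncard (fun w hw => ?_)
        have h := zero_or_zero_of_prod hE w
        have h' := hf' (E₁.prodEquivOfIsCompl E₂ hE w) (by simp at hw; tauto)
        simp only [Set.mem_ofPred_eq, LinearEquiv.coe_toEquiv, h']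
        simp

theorem le_hammingNorm_union_extendLeft (hE : IsCompl E₁ E₂) (hf0 : f 0 = 0)
    (hf : ∀ x, x ≠ 0 → (x ∈ E₁ ∨ x ∈ E₂) → f x = 1) (hf' : ∀ x, ¬(x ∈ E₁ ∨ x ∈ E₂) → f x = 0)
    {a : Module.Dual K E₁} (ha : a ≠ 0) :
    (Nat.card E₂ - 1) + (Nat.card E₁ - (Nat.card K ^ (Module.finrank K E₁ - 1) + 1)) +
      (Nat.card E₁ - Nat.card K ^ (Module.finrank K E₁ - 1)) * (Nat.card E₂ - 1) ≤
      hammingNorm (functionEncoder f (1, extendLeft hE a)) := by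
  rw [hammingNorm_functionEncoder hf0 (E₁.prodEquivOfIsCompl E₂ hE).toEquiv]
  calc _ = (({0} : Set E₁) ×ˢ ({0}ᶜ : Set E₂) ∪ {x : E₁ | x ≠ 0 ∧ a x ≠ 1} ×ˢ ({0} : Set E₂) ∪
          {x : E₁ | a x ≠ 0} ×ˢ ({0}ᶜ : Set E₂)).ncard := by
        rw [Set.ncard_union_eq, Set.ncard_union_eq]
        · simp only [Set.ncard_prod, ncard_compl_zero, Set.ncard_singleton, mul_one, one_mul,
            ncard_ne_zero_and_dual_ne_one ha, ncard_dual_ne_zero ha]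
        · rw [Set.disjoint_left]
          rintro ⟨x, y⟩
          simp
          tauto
        · rw [Set.disjoint_left]
          rintro ⟨x, y⟩ h
          simp at h ⊢
          rintro h1
          rcases h with h | h
          · simp [h.1] at h1
          · exact h.2
    _ ≤ _ := by
        refine Set.ncard_le_ncard (fun w hw => ?_)
        have h := zero_or_zero_of_prod hE w
        have h1 := hf (E₁.prodEquivOfIsCompl E₂ hE w)
        have h0 := hf' (E₁.prodEquivOfIsCompl E₂ hE w)
        have hl := extendLeft_apply hE a w
        have hw0 : E₁.prodEquivOfIsCompl E₂ hE w = 0 ↔ w.1 = 0 ∧ w.2 = 0 := by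
          rw [LinearEquiv.map_eq_zero_iff, Prod.ext_iff]; rfl
        simp only [Set.mem_union, Set.mem_prod, Set.mem_singleton_iff, Set.mem_compl_iff,
          Set.mem_ofPred_eq, LinearEquiv.coe_toEquiv, one_mul] at hw ⊢
        rw [hl]
        rcases hw with (hw | hw) | hw
        · rw [h1 (by tauto) (by tauto), hw.1]
          simp
        · rw [h1 (by tauto) (by tauto)]
          exact hw.1.2.symm
        · have hx : w.1 ≠ 0 := by
            intro hx
            exact hw.1 (by simp [hx])
          rw [h0 (by tauto)]
          exact hw.1.symm

theorem hammingNorm_compl_extendLeft_le (hE : IsCompl E₁ E₂)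
    (hf : ∀ x, (x ∈ E₁ ∨ x ∈ E₂) → f x = 0) (hf' : ∀ x, ¬(x ∈ E₁ ∨ x ∈ E₂) → f x = 1)
    {a : Module.Dual K E₁} (ha : a ≠ 0) :
    hammingNorm (functionEncoder f (1, extendLeft hE a)) ≤
      (Nat.card E₁ - (Nat.card K ^ (Module.finrank K E₁ - 1) + 1)) * (Nat.card E₂ - 1) +
        (Nat.card E₁ - Nat.card K ^ (Module.finrank K E₁ - 1)) := by
  rw [hammingNorm_functionEncoder (hf 0 (Or.inl E₁.zero_mem))
    (E₁.prodEquivOfIsCompl E₂ hE).toEquiv]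
  calc _ ≤ ({x : E₁ | x ≠ 0 ∧ a x ≠ 1} ×ˢ ({0}ᶜ : Set E₂) ∪
          {x : E₁ | a x ≠ 0} ×ˢ ({0} : Set E₂)).ncard := by
        refine Set.ncard_le_ncard (fun w hw => ?_)
        have h := zero_or_zero_of_prod hE w
        have h0 := hf (E₁.prodEquivOfIsCompl E₂ hE w)
        have h1 := hf' (E₁.prodEquivOfIsCompl E₂ hE w)
        simp only [Set.mem_union, Set.mem_prod, Set.mem_singleton_iff, Set.mem_compl_iff,
          Set.mem_ofPred_eq, LinearEquiv.coe_toEquiv, one_mul, extendLeft_apply] at hw ⊢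
        by_cases hx : w.1 = 0
        · rw [h0 (by tauto), hx] at hw
          simp at hw
        · by_cases hy : w.2 = 0
          · rw [h0 (by tauto)] at hw
            exact Or.inr ⟨hw.symm, hy⟩
          · rw [h1 (by tauto)] at hw
            exact Or.inl ⟨⟨hx, hw.symm⟩, hy⟩
    _ ≤ _ := by
        refine (Set.ncard_union_le _ _).trans ?_
        simp only [Set.ncard_prod, ncard_compl_zero, Set.ncard_singleton, mul_one,
          ncard_ne_zero_and_dual_ne_one ha, ncard_dual_ne_zero ha, le_refl]

end Weights

theorem union_weight_inequality {p k b : ℕ} (hp : 2 ≤ p) (hk : 2 ≤ k) (hb : p * (p * k) ≤ b) :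
    p * ((p * k - 1) + (b - 1)) ≤
      (p - 1) * ((b - 1) + (p * k - (k + 1)) + (p * k - k) * (b - 1)) := by
  have h1 : k + 1 ≤ p * k := by nlinarith
  have h2 : 1 ≤ b := by nlinarith
  obtain ⟨r, rfl⟩ : ∃ r, p = r + 1 := ⟨p - 1, by omega⟩
  have hr : 1 ≤ r := by omega
  rw [Nat.add_sub_cancel]
  zify [h1, h2, (by omega : 1 ≤ (r + 1) * k), (by omega : k ≤ (r + 1) * k)] at *
  have h3 : (b : ℤ) ≤ (r : ℤ) ^ 2 * b := le_mul_of_one_le_left (by omega) (one_le_pow₀ hr)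
  have h4 : 2 * ((r : ℤ) ^ 2 * b) ≤ k * ((r : ℤ) ^ 2 * b) :=
    mul_le_mul_of_nonneg_right hk (by positivity)
  nlinarith

theorem compl_weight_inequality {p k b : ℕ} (hp : 2 ≤ p) (hk : 2 ≤ k) (hb : p * (p * k) ≤ b) :
    p * ((p * k - (k + 1)) * (b - 1) + (p * k - k)) ≤ (p - 1) * ((p * k - 1) * (b - 1)) := by
  have h1 : k + 1 ≤ p * k := by nlinarith
  have h2 : 1 ≤ b := by nlinarith
  zify [h1, h2, (by omega : 1 ≤ p), (by omega : 1 ≤ p * k), (by omega : k ≤ p * k)] at *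
  nlinarith

/-- A nonempty bounded set of weights has extrema, and any two of its elements compare them. -/
theorem exists_weight_extrema {S : Set ℕ} (hS : BddAbove S) {p c d : ℕ} (hc : c ∈ S) (hd : d ∈ S)
    (h : p * c ≤ (p - 1) * d) :
    ∃ wmin wmax : ℕ, IsLeast S wmin ∧ IsGreatest S wmax ∧ p * wmin ≤ (p - 1) * wmax :=
  ⟨sInf S, sSup S, ⟨Nat.sInf_mem ⟨c, hc⟩, fun _ hx => Nat.sInf_le hx⟩,
    ⟨Nat.sSup_mem ⟨c, hc⟩ hS, fun _ hx => le_csSup hS hx⟩,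
    ((Nat.mul_le_mul_left p (Nat.sInf_le hc)).trans h).trans
      (Nat.mul_le_mul_left _ (le_csSup hS hd))⟩

theorem bddAbove_weights {K ι : Type*} [Fintype ι] [DecidableEq K] [Zero K] (C : Set (ι → K)) :
    BddAbove {w | ∃ a ∈ C, a ≠ 0 ∧ hammingNorm a = w} := by
  refine ⟨Fintype.card ι, ?_⟩
  rintro w ⟨a, -, -, rfl⟩
  exact hammingNorm_le_card_fintype

theorem functionEncoder_mem_weights {K V : Type*} [Field K] [AddCommGroup V] [Module K V]
    [DecidableEq K] [Fintype {x : V // x ≠ 0}] {f : V → K} (h : LinearWordsSeparate f)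
    (l : Module.Dual K V) :
    hammingNorm (functionEncoder f (1, l)) ∈
      {w | ∃ a ∈ Set.range (functionEncoder f), a ≠ 0 ∧ hammingNorm a = w} := by
  refine ⟨_, ⟨_, rfl⟩, fun h0 => ?_, rfl⟩
  have := functionEncoder_injective h (h0.trans (map_zero _).symm)
  simp at this

theorem finrank_span_functionEncoder {K V : Type*} [Field K] [AddCommGroup V] [Module K V]
    [FiniteDimensional K V] {f : V → K} (h : LinearWordsSeparate f) :
    Module.finrank K (Submodule.span K (Set.range (functionEncoder f))) =
      Module.finrank K V + 1 := by
  rw [← LinearMap.coe_range, Submodule.span_eq,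
    LinearMap.finrank_range_of_inj (functionEncoder_injective h), Module.finrank_prod,
    Module.finrank_self, Subspace.dual_finrank_eq, add_comm]

theorem range_trace_code {K F : Type*} [Field K] [Field F] [Algebra K F] [FiniteDimensional K F]
    [Algebra.IsSeparable K F] (f : F → K) :
    Set.range (fun (uv : K × F) (x : {x : F // x ≠ 0}) =>
      uv.1 * f x.1 - Algebra.trace K F (uv.2 * x.1)) = Set.range (functionEncoder f) := by
  let e := (Algebra.traceForm K F).toDual (traceForm_nondegenerate K F)
  ext c
  constructor
  · rintro ⟨⟨u, v⟩, rfl⟩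
    exact ⟨(u, e v), rfl⟩
  · rintro ⟨⟨u, l⟩, rfl⟩
    refine ⟨(u, e.symm l), funext fun x => ?_⟩
    have h : e (e.symm l) x.1 = l x.1 := by rw [e.apply_symm_apply]
    simp only [functionEncoder_apply, ← h]
    rfl

open scoped Classical in
/-- Let `E_1, E_2` be `F_p`-subspaces of `F_q` with `dim E_i = t_i`,
`t_1 + t_2 = m`, `2 ≤ t_1 < t_2 ≤ m − 2`, `E_1 ∩ E_2 = {0}` and `E_1^⊥ ∩ E_2^⊥ = {0}`;
`D = (E_1 ∪ E_2) \ {0}` and `D̄ = F_q^* \ D`. Then `C_{f_D}` and `C_{f_{D̄}}` are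
`[p^m − 1, m + 1]` minimal linear codes with `w_min/w_max ≤ (p−1)/p`. -/
theorem minimal_codes_from_two_complementary_subspaces
    {p m t₁ t₂ : ℕ} [Fact p.Prime]
    (F : Type) [Field F] [Fintype F] [Algebra (ZMod p) F]
    (hF : Fintype.card F = p ^ m) (hrank : Module.finrank (ZMod p) F = m)
    (E₁ E₂ : Submodule (ZMod p) F)
    (hd₁ : Module.finrank (ZMod p) E₁ = t₁) (hd₂ : Module.finrank (ZMod p) E₂ = t₂)
    (hsum : t₁ + t₂ = m) (h2t : 2 ≤ t₁) (h12 : t₁ < t₂) (htm : t₂ ≤ m - 2)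
    (hint : E₁ ⊓ E₂ = ⊥)
    (hdual : LinearMap.BilinForm.orthogonal (Algebra.traceForm (ZMod p) F) E₁ ⊓
      LinearMap.BilinForm.orthogonal (Algebra.traceForm (ZMod p) F) E₂ = ⊥) :
    -- the absolute trace
    let Tr : F → ZMod p := fun x => Algebra.trace (ZMod p) F x
    -- characteristic functions of `D = (E_1 ∪ E_2) \ {0}` and of `D̄ = F_q^* \ D`
    let fD : F → ZMod p := fun x => if (x ∈ E₁ ∨ x ∈ E₂) ∧ x ≠ 0 then 1 else 0
    let fDbar : F → ZMod p := fun x => if x ≠ 0 ∧ ¬(x ∈ E₁ ∨ x ∈ E₂) then 1 else 0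
    -- the two codes, with codewords indexed by `x ∈ F_q^*`
    let cD : ZMod p × F → ({x : F // x ≠ 0} → ZMod p) :=
      fun uv x => uv.1 * fD x.1 - Tr (uv.2 * x.1)
    let cDbar : ZMod p × F → ({x : F // x ≠ 0} → ZMod p) :=
      fun uv x => uv.1 * fDbar x.1 - Tr (uv.2 * x.1)
    let CD : Set ({x : F // x ≠ 0} → ZMod p) := Set.range cD
    let CDbar : Set ({x : F // x ≠ 0} → ZMod p) := Set.range cDbar
    -- minimality of a code
    let Minimal : Set ({x : F // x ≠ 0} → ZMod p) → Prop := fun C =>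
      ∀ a ∈ C, a ≠ 0 → ∀ b ∈ C, (∀ i, b i ≠ 0 → a i ≠ 0) → ∃ k : ZMod p, b = k • a
    -- the set of nonzero Hamming weights of a code
    let S : Set ({x : F // x ≠ 0} → ZMod p) → Set ℕ := fun C =>
      {w | ∃ a ∈ C, a ≠ 0 ∧ hammingNorm a = w}
    -- length `p^m − 1`
    (Fintype.card {x : F // x ≠ 0} = p ^ m - 1) ∧
    -- dimension `m + 1` for both codes
    (Module.finrank (ZMod p) (Submodule.span (ZMod p) CD) = m + 1) ∧
    (Module.finrank (ZMod p) (Submodule.span (ZMod p) CDbar) = m + 1) ∧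
    -- both codes are minimal
    Minimal CD ∧ Minimal CDbar ∧
    -- both satisfy `w_min/w_max ≤ (p−1)/p`
    (∃ wmin wmax : ℕ, IsLeast (S CD) wmin ∧ IsGreatest (S CD) wmax ∧
      p * wmin ≤ (p - 1) * wmax) ∧
    (∃ wmin wmax : ℕ, IsLeast (S CDbar) wmin ∧ IsGreatest (S CDbar) wmax ∧
      p * wmin ≤ (p - 1) * wmax) := by
  intro Tr fD fDbar cD cDbar CD CDbar Minimal S
  have : FiniteDimensional (ZMod p) F := Module.Finite.of_finite
  have hp : 2 ≤ p := (Fact.out : p.Prime).two_le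
  have hE : IsCompl E₁ E₂ := by
    rw [Submodule.isCompl_iff_disjoint _ _ (by omega)]
    exact disjoint_iff.mpr hint
  have hCD : CD = Set.range (functionEncoder fD) := range_trace_code fD
  have hCDbar : CDbar = Set.range (functionEncoder fDbar) := range_trace_code fDbar
  have hD0 : fD 0 = 0 := if_neg (by simp)
  have hDin : ∀ x, x ≠ 0 → (x ∈ E₁ ∨ x ∈ E₂) → fD x = 1 := fun x h0 h => if_pos ⟨h, h0⟩
  have hDout : ∀ x, ¬(x ∈ E₁ ∨ x ∈ E₂) → fD x = 0 := fun x h => if_neg (by tauto)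
  have hDbarin : ∀ x, (x ∈ E₁ ∨ x ∈ E₂) → fDbar x = 0 := fun x h => if_neg (by tauto)
  have hDbarout : ∀ x, ¬(x ∈ E₁ ∨ x ∈ E₂) → fDbar x = 1 := fun x h =>
    if_pos ⟨ne_zero_of_notMem_left_or_right h, h⟩
  have hDsep : LinearWordsSeparate fD := linearWordsSeparate_of_union (E₁ := E₁) (by omega) hDin
  have hDbarsep : LinearWordsSeparate fDbar :=
    linearWordsSeparate_of_compl hE.disjoint (by omega) (by omega) hDbarin hDbarout
  have hDspan : NonlinearZerosSpan fD :=
    nonlinearZerosSpan_of_union hE (by omega) (by omega) hDin hDout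
  have hDbarspan : NonlinearZerosSpan fDbar :=
    nonlinearZerosSpan_of_compl hE (by omega) (by omega) hDbarin hDbarout
  obtain ⟨a, ha⟩ : ∃ a : Module.Dual (ZMod p) E₁, a ≠ 0 := by
    have : Nontrivial E₁ := Module.nontrivial_of_finrank_pos (R := ZMod p) (by omega)
    exact exists_ne 0
  have hc₁ : Nat.card E₁ = p * p ^ (t₁ - 1) := by
    rw [Module.natCard_eq_pow_finrank (K := ZMod p), Nat.card_zmod, hd₁, ← pow_succ']
    congr 1
    omega
  have hc₂ : p * (p * p ^ (t₁ - 1)) ≤ Nat.card E₂ := by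
    rw [Module.natCard_eq_pow_finrank (K := ZMod p), Nat.card_zmod, hd₂, ← pow_succ', ← pow_succ']
    exact Nat.pow_le_pow_right (by omega) (by omega)
  have hk : 2 ≤ p ^ (t₁ - 1) := hp.trans (Nat.le_self_pow (by omega) p)
  refine ⟨?_, ?_, ?_, ?_, ?_, ?_, ?_⟩
  · rw [Fintype.card_subtype_compl, Fintype.card_subtype_eq, hF]
  · rw [hCD, finrank_span_functionEncoder hDsep, hrank]
  · rw [hCDbar, finrank_span_functionEncoder hDbarsep, hrank]
  · rw [hCD]
    rintro _ ⟨a, rfl⟩ - _ ⟨b, rfl⟩ hab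
    exact functionEncoder_minimal hDsep hDspan hab
  · rw [hCDbar]
    rintro _ ⟨a, rfl⟩ - _ ⟨b, rfl⟩ hab
    exact functionEncoder_minimal hDbarsep hDbarspan hab
  · rw [hCD]
    refine exists_weight_extrema (bddAbove_weights _) (functionEncoder_mem_weights hDsep 0)
      (functionEncoder_mem_weights hDsep (extendLeft hE a)) ?_
    have hmin := hammingNorm_union_le hE hD0 hDout
    have hmax := le_hammingNorm_union_extendLeft hE hD0 hDin hDout ha
    rw [hc₁] at hmin
    rw [hc₁, hd₁, Nat.card_zmod] at hmax
    exact (Nat.mul_le_mul_left _ hmin).trans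
      ((union_weight_inequality hp hk hc₂).trans (Nat.mul_le_mul_left _ hmax))
  · rw [hCDbar]
    refine exists_weight_extrema (bddAbove_weights _)
      (functionEncoder_mem_weights hDbarsep (extendLeft hE a))
      (functionEncoder_mem_weights hDbarsep 0) ?_
    have hmin := hammingNorm_compl_extendLeft_le hE hDbarin hDbarout ha
    have hmax := le_hammingNorm_compl hE (hDbarin 0 (Or.inl E₁.zero_mem)) hDbarout
    rw [hc₁, hd₁, Nat.card_zmod] at hmin
    rw [hc₁] at hmax
    exact (Nat.mul_le_mul_left _ hmin).trans
      ((compl_weight_inequality hp hk hc₂).trans (Nat.mul_le_mul_left _ hmax))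
end

section
/- Let D ⊆ F_q^* and for β ∈ F_q let c_β = (Tr(βx))_{x∈D}. Then for every β ∈ F_q^*, the Hamming weight of c_β satisfies wt(c_β) = ((p−1)/p)·|D| − (1/(p(ζ_p − 1)))·Σ_{y∈F_p^*} f̂_D(yβ), where f_D is the characteristic function of D. -/
open Finset

/-- The sum of a primitive additive character over the nonzero multiples of `-t`. -/
lemma AddChar.IsPrimitive.sum_nonzero_neg_mul {R : Type*} [CommRing R] [Fintype R] [DecidableEq R]
    {ψ : AddChar R ℂ} (hψ : ψ.IsPrimitive) (t : R) :
    ∑ y ∈ univ \ {(0 : R)}, ψ (-(y * t)) = (if t = 0 then (Fintype.card R : ℂ) else 0) - 1 := by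
  have h := AddChar.sum_mulShift (-t) hψ
  rw [← Finset.sum_sdiff (Finset.subset_univ {(0 : R)})] at h
  simp only [mul_neg, neg_eq_zero, Finset.sum_singleton, zero_mul, neg_zero,
    AddChar.map_zero_eq_one] at h
  rw [eq_sub_iff_add_eq, h]
  split_ifs <;> simp

/-- A primitive additive character of a finite field `K`, composed with `x ↦ -Tr(w x)` for a
nonzero `w` in a finite extension `F`, sums to zero over `F`. -/
lemma AddChar.IsPrimitive.sum_neg_trace_mul {K F : Type*} [Field K] [Finite K] [Field F]
    [Fintype F] [Algebra K F] {ψ : AddChar K ℂ} (hψ : ψ.IsPrimitive) {w : F} (hw : w ≠ 0) :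
    ∑ x : F, ψ (-Algebra.trace K F (w * x)) = 0 := by
  let χ : AddChar F ℂ :=
    ψ.compAddMonoidHom ((-(Algebra.trace K F)).comp (LinearMap.mulLeft K w)).toAddMonoidHom
  have hχ : χ ≠ 1 := by
    obtain ⟨a, ha⟩ := AddChar.ne_one_iff.mp (hψ one_ne_zero)
    obtain ⟨z, hz⟩ := Algebra.trace_surjective K F (-a)
    refine AddChar.ne_one_iff.mpr ⟨w⁻¹ * z, ?_⟩
    simpa [χ, hw, hz] using ha
  simpa [χ] using AddChar.sum_eq_zero_of_ne_one hχ

/-- For `D ⊆ F_q^*` and `c_β = (Tr(βx))_{x ∈ D}`, the Hamming weight of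
`c_β` for `β ∈ F_q^*` satisfies
`wt(c_β) = ((p−1)/p)·|D| − (1/(p(ζ_p − 1)))·Σ_{y ∈ F_p^*} f̂_D(yβ)`. -/
theorem weight_defining_set_codeword_eq
    {p m : ℕ} [Fact p.Prime] (hm : 0 < m)
    (F : Type) [Field F] [Fintype F] [DecidableEq F]
    [Algebra (ZMod p) F] (hF : Fintype.card F = p ^ m)
    (D : Finset F) (hD : (0 : F) ∉ D) :
    -- the primitive `p`-th root of unity `ζ_p = exp(2πi/p)`
    let ζ : ℂ := Complex.exp (2 * Real.pi * Complex.I / p)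
    -- the absolute trace
    let Tr : F → ZMod p := fun x => Algebra.trace (ZMod p) F x
    -- the characteristic function of `D`
    let fD : F → ZMod p := fun x => if x ∈ D then 1 else 0
    -- the Walsh transform of `f_D`
    let W : F → ℂ := fun w => ∑ x : F, ζ ^ (((fD x).val : ℤ) - ((Tr (w * x)).val : ℤ))
    ∀ β : F, β ≠ 0 →
      (hammingNorm (fun x : D => Tr (β * x)) : ℂ) =
        (((p : ℂ) - 1) / p) * D.card -
          (1 / ((p : ℂ) * (ζ - 1))) * ∑ y ∈ Finset.univ \ {(0 : ZMod p)}, W (y • β) := by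
  intro ζ Tr fD W β hβ
  have hp : p.Prime := Fact.out
  have hp0 : (p : ℂ) ≠ 0 := Nat.cast_ne_zero.mpr hp.ne_zero
  have hζ : IsPrimitiveRoot ζ p := Complex.isPrimitiveRoot_exp p hp.ne_zero
  have hζ1 : ζ - 1 ≠ 0 := sub_ne_zero.mpr (hζ.ne_one hp.one_lt)
  have hζ0 : ζ ≠ 0 := hζ.ne_zero hp.ne_zero
  obtain ⟨ψ, hψ, hψ_apply⟩ : ∃ ψ : AddChar (ZMod p) ℂ, ψ.IsPrimitive ∧ ∀ a, ψ a = ζ ^ a.val :=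
    ⟨_, AddChar.zmodChar_primitive_of_primitive_root p hζ, AddChar.zmodChar_apply _⟩
  have hW (w : F) (hw : w ≠ 0) : W w = (ζ - 1) * ∑ x ∈ D, ψ (-Tr (w * x)) := by
    have key (x : F) : ζ ^ (((fD x).val : ℤ) - ((Tr (w * x)).val : ℤ)) =
        ψ (-Tr (w * x)) + if x ∈ D then (ζ - 1) * ψ (-Tr (w * x)) else 0 := by
      rw [zpow_sub₀ hζ0, zpow_natCast, zpow_natCast, ← hψ_apply (Tr (w * x)),
        AddChar.map_neg_eq_inv]
      by_cases hx : x ∈ D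
      · simp only [fD, hx, if_true, ZMod.val_one, pow_one]
        ring
      · simp [fD, hx]
    simp only [W, key, Finset.sum_add_distrib]
    rw [hψ.sum_neg_trace_mul hw, zero_add, Finset.mul_sum, Finset.sum_ite_mem, univ_inter]
  have hsum : ∑ y ∈ univ \ {(0 : ZMod p)}, W (y • β) =
      (ζ - 1) * (p * #{x ∈ D | Tr (β * x) = 0} - #D) := by
    have hy : ∀ y ∈ univ \ {(0 : ZMod p)},
        W (y • β) = (ζ - 1) * ∑ x ∈ D, ψ (-(y * Tr (β * x))) := by
      intro y hy
      rw [hW _ (smul_ne_zero (by simpa using hy) hβ)]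
      simp [Tr]
    rw [Finset.sum_congr rfl hy, ← Finset.mul_sum, Finset.sum_comm]
    simp only [hψ.sum_nonzero_neg_mul, ZMod.card, Finset.sum_sub_distrib, ← Finset.sum_filter]
    simp [mul_comm]
  have hwt : hammingNorm (fun x : D => Tr (β * x)) + #{x ∈ D | Tr (β * x) = 0} = #D := by
    rw [← Finset.card_filter_add_card_filter_not (s := D) (fun x => Tr (β * x) = 0), add_comm]
    congr 1
    rw [hammingNorm, Finset.univ_eq_attach, Finset.filter_attach (fun x => Tr (β * x) ≠ 0) D]
    simp
  rw [hsum, ← hwt]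
  push_cast
  field_simp
  ring
end

section
/- Let p = 2, let D ⊆ F_q^*, and let C_D = {(Tr(βx))_{x∈D} : β ∈ F_q} have dimension m over F_2. Then C_D is a minimal code if and only if f̂_D(β_1 + β_2) − f̂_D(β_1) − f̂_D(β_2) ≠ 2|D| for all distinct β_1, β_2 ∈ F_q^*. Furthermore, if |f̂_D(β)| < (2/3)|D| for every β ∈ F_q^*, then C_D is minimal. -/
open Finset

/-- The nontrivial additive character of `ZMod 2`, with integer values. -/
def binarySign (t : ZMod 2) : ℤ := (-1) ^ t.val

theorem binarySign_add (s t : ZMod 2) :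
    binarySign (s + t) = binarySign s * binarySign t := by
  revert s t; decide

theorem binarySign_one : binarySign 1 = -1 := by decide

theorem one_sub_binarySign_nonneg (t : ZMod 2) : 0 ≤ 1 - binarySign t := by
  revert t; decide

theorem one_sub_binarySign_eq_zero (t : ZMod 2) : 1 - binarySign t = 0 ↔ t = 0 := by
  revert t; decide

section Trace

variable {F : Type} [Field F] [Fintype F] [Algebra (ZMod 2) F]

theorem sum_binarySign_trace_mul {w : F} (hw : w ≠ 0) :
    ∑ x : F, binarySign (Algebra.trace (ZMod 2) F (w * x)) = 0 := by
  obtain ⟨z, hz⟩ := Algebra.trace_surjective (ZMod 2) F 1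
  have key : ∑ x : F, binarySign (Algebra.trace (ZMod 2) F (w * x)) =
      ∑ x : F, -binarySign (Algebra.trace (ZMod 2) F (w * x)) := by
    rw [← Equiv.sum_comp (Equiv.addRight (w⁻¹ * z))]
    refine Finset.sum_congr rfl fun x _ => ?_
    rw [Equiv.coe_addRight, mul_add, mul_inv_cancel_left₀ hw, map_add, hz, binarySign_add,
      binarySign_one, mul_neg_one]
  rw [Finset.sum_neg_distrib] at key
  linarith

/-- The Walsh transform of an indicator function away from zero is a character sum over the set. -/
theorem walsh_indicator_eq [DecidableEq F] (D : Finset F) {w : F} (hw : w ≠ 0) :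
    ∑ x : F, (-1 : ℤ) ^ ((if x ∈ D then (1 : ZMod 2) else 0).val +
        (Algebra.trace (ZMod 2) F (w * x)).val) =
      -2 * ∑ x ∈ D, binarySign (Algebra.trace (ZMod 2) F (w * x)) := by
  have h : ∀ x : F, (-1 : ℤ) ^ ((if x ∈ D then (1 : ZMod 2) else 0).val +
        (Algebra.trace (ZMod 2) F (w * x)).val) =
      binarySign (Algebra.trace (ZMod 2) F (w * x)) +
        -2 * (if x ∈ D then binarySign (Algebra.trace (ZMod 2) F (w * x)) else 0) := by
    intro x
    rw [pow_add]
    split_ifs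
    · simp only [binarySign, ZMod.val_one]
      ring
    · simp [binarySign]
  rw [Finset.sum_congr rfl fun x _ => h x, Finset.sum_add_distrib, sum_binarySign_trace_mul hw,
    ← Finset.mul_sum, Finset.sum_ite_mem, Finset.univ_inter, zero_add]

/-- The encoding map of the defining-set code of `D`. -/
noncomputable def traceEncoding (D : Finset F) : F →ₗ[ZMod 2] (D → ZMod 2) :=
  LinearMap.pi fun x => (Algebra.trace (ZMod 2) F).comp (LinearMap.mulRight (ZMod 2) (x : F))

theorem traceEncoding_injective {m : ℕ} (hF : Fintype.card F = 2 ^ m) (D : Finset F)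
    (h : Module.finrank (ZMod 2) (Submodule.span (ZMod 2)
      (Set.range fun (β : F) (x : D) => Algebra.trace (ZMod 2) F (β * x))) = m) :
    Function.Injective (traceEncoding D) := by
  have hspan : Submodule.span (ZMod 2)
      (Set.range fun (β : F) (x : D) => Algebra.trace (ZMod 2) F (β * x)) =
      LinearMap.range (traceEncoding D) :=
    Submodule.span_eq (LinearMap.range (traceEncoding D))
  have hm : Module.finrank (ZMod 2) F = m := by
    have := Module.card_eq_pow_finrank (K := ZMod 2) (V := F)
    rw [hF, ZMod.card] at this
    exact (Nat.pow_right_injective le_rfl this).symm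
  have hk := LinearMap.finrank_range_add_finrank_ker (traceEncoding D)
  rw [← hspan, h, hm] at hk
  rw [← LinearMap.ker_eq_bot]
  exact Submodule.finrank_eq_zero.mp (by omega)

end Trace

/-- Extremality of the Walsh values expresses disjointness of the supports of two codewords. -/
theorem sum_binarySign_eq_card_iff {F : Type} [Field F] [Algebra (ZMod 2) F]
    (D : Finset F) (β₁ β₂ : F) :
    -2 * ∑ x ∈ D, binarySign (Algebra.trace (ZMod 2) F ((β₁ + β₂) * x)) -
        -2 * ∑ x ∈ D, binarySign (Algebra.trace (ZMod 2) F (β₁ * x)) -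
        -2 * ∑ x ∈ D, binarySign (Algebra.trace (ZMod 2) F (β₂ * x)) = 2 * (D.card : ℤ) ↔
      ∀ x ∈ D, Algebra.trace (ZMod 2) F (β₁ * x) = 0 ∨ Algebra.trace (ZMod 2) F (β₂ * x) = 0 := by
  have hsum : ∑ x ∈ D, (1 - binarySign (Algebra.trace (ZMod 2) F (β₁ * x))) *
        (1 - binarySign (Algebra.trace (ZMod 2) F (β₂ * x))) =
      D.card - ∑ x ∈ D, binarySign (Algebra.trace (ZMod 2) F (β₁ * x)) -
        ∑ x ∈ D, binarySign (Algebra.trace (ZMod 2) F (β₂ * x)) +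
        ∑ x ∈ D, binarySign (Algebra.trace (ZMod 2) F ((β₁ + β₂) * x)) := by
    rw [Finset.card_eq_sum_ones, Nat.cast_sum, ← Finset.sum_sub_distrib,
      ← Finset.sum_sub_distrib, ← Finset.sum_add_distrib]
    refine Finset.sum_congr rfl fun x _ => ?_
    rw [add_mul, map_add, binarySign_add]
    push_cast
    ring
  have hzero := Finset.sum_eq_zero_iff_of_nonneg (s := D)
    (f := fun x => (1 - binarySign (Algebra.trace (ZMod 2) F (β₁ * x))) *
        (1 - binarySign (Algebra.trace (ZMod 2) F (β₂ * x))))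
    fun x _ => mul_nonneg (one_sub_binarySign_nonneg _) (one_sub_binarySign_nonneg _)
  simp only [mul_eq_zero, one_sub_binarySign_eq_zero] at hzero
  rw [← hzero, hsum]
  constructor <;> intro h <;> linarith

/-- Let `p = 2`, `D ⊆ F_q^*`, and let
`C_D = {(Tr(βx))_{x ∈ D} : β ∈ F_q}` have dimension `m` over `F_2`. Then `C_D` is minimal
if and only if `f̂_D(β_1 + β_2) − f̂_D(β_1) − f̂_D(β_2) ≠ 2|D|` for all distinct
`β_1, β_2 ∈ F_q^*`. Furthermore, if `|f̂_D(β)| < (2/3)|D|` for every `β ∈ F_q^*`, then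
`C_D` is minimal. -/
theorem binary_defining_set_code_minimal_iff
    {m : ℕ} (hm : 0 < m)
    (F : Type) [Field F] [Fintype F] [DecidableEq F]
    [Algebra (ZMod 2) F] (hF : Fintype.card F = 2 ^ m)
    (D : Finset F) (hD : (0 : F) ∉ D) :
    -- the absolute trace
    let Tr : F → ZMod 2 := fun x => Algebra.trace (ZMod 2) F x
    -- the characteristic function of `D`
    let fD : F → ZMod 2 := fun x => if x ∈ D then 1 else 0
    -- the Walsh transform of `f_D` (with `ζ_2 = −1`)
    let W : F → ℤ := fun w => ∑ x : F, (-1 : ℤ) ^ ((fD x).val + (Tr (w * x)).val)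
    -- the codewords of `C_D`, indexed by `x ∈ D`
    let cw : F → (D → ZMod 2) := fun β x => Tr (β * x)
    let CD : Set (D → ZMod 2) := Set.range cw
    -- minimality of `C_D`
    let Minimal : Prop :=
      ∀ a ∈ CD, a ≠ 0 → ∀ b ∈ CD, (∀ i, b i ≠ 0 → a i ≠ 0) → ∃ k : ZMod 2, b = k • a
    -- `C_D` has dimension `m`
    (Module.finrank (ZMod 2) (Submodule.span (ZMod 2) CD) = m) →
    (Minimal ↔
      (∀ β₁ β₂ : F, β₁ ≠ 0 → β₂ ≠ 0 → β₁ ≠ β₂ →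
        W (β₁ + β₂) - W β₁ - W β₂ ≠ 2 * D.card)) ∧
    ((∀ β : F, β ≠ 0 → 3 * |W β| < 2 * D.card) → Minimal) := by
  intro Tr fD W cw CD Minimal hdim
  have hinj : Function.Injective cw := traceEncoding_injective hF D hdim
  have hW : ∀ w : F, w ≠ 0 → W w = -2 * ∑ x ∈ D, binarySign (Tr (w * x)) :=
    fun w hw => walsh_indicator_eq D hw
  have hcw0 : cw 0 = 0 := map_zero (traceEncoding D)
  have hadd : ∀ β γ : F, cw (β + γ) = cw β + cw γ := map_add (traceEncoding D)
  have : CharP F 2 := charP_of_injective_algebraMap (algebraMap (ZMod 2) F).injective 2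
  have hne : ∀ β γ : F, β ≠ γ → β + γ ≠ 0 := fun β γ h h0 => h (CharTwo.add_eq_zero.mp h0)
  have hdisj : ∀ β₁ β₂ : F, β₁ ≠ 0 → β₂ ≠ 0 → β₁ ≠ β₂ →
      (W (β₁ + β₂) - W β₁ - W β₂ = 2 * D.card ↔ ∀ x : D, cw β₁ x = 0 ∨ cw β₂ x = 0) := by
    intro β₁ β₂ h₁ h₂ h
    rw [hW _ h₁, hW _ h₂, hW _ (hne _ _ h), Subtype.forall]
    exact sum_binarySign_eq_card_iff D β₁ β₂
  have hiff : Minimal ↔ ∀ β₁ β₂ : F, β₁ ≠ 0 → β₂ ≠ 0 → β₁ ≠ β₂ →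
      W (β₁ + β₂) - W β₁ - W β₂ ≠ 2 * D.card := by
    constructor
    · intro hmin β₁ β₂ h₁ h₂ h heq
      have hd := (hdisj β₁ β₂ h₁ h₂ h).mp heq
      obtain ⟨k, hk⟩ := hmin (cw (β₁ + β₂)) ⟨_, rfl⟩
        (fun h0 => hne _ _ h (hinj (h0.trans hcw0.symm))) (cw β₁) ⟨_, rfl⟩ (by
          intro i hi
          rw [hadd, Pi.add_apply, (hd i).resolve_left hi, add_zero]
          exact hi)
      have hk' : k = 0 ∨ k = 1 := by clear hk; revert k; decide
      obtain rfl | rfl := hk'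
      · rw [zero_smul] at hk
        exact h₁ (hinj (hk.trans hcw0.symm))
      · rw [one_smul] at hk
        exact h₂ (left_eq_add.mp (hinj hk))
    · rintro hall _ ⟨α, rfl⟩ hα _ ⟨β, rfl⟩ hsub
      have hα0 : α ≠ 0 := by
        rintro rfl
        exact hα hcw0
      by_cases hβ : β = 0
      · exact ⟨0, by rw [hβ, hcw0, zero_smul]⟩
      by_cases hαβ : α = β
      · exact ⟨1, by rw [hαβ, one_smul]⟩
      refine absurd ((hdisj (α + β) β (hne _ _ hαβ) hβ
        (fun h => hα0 (add_eq_right.mp h))).mpr fun x => ?_) (hall _ _ (hne _ _ hαβ) hβ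
        (fun h => hα0 (add_eq_right.mp h)))
      have hx := hsub x
      rw [hadd, Pi.add_apply]
      generalize cw α x = s at hx ⊢
      generalize cw β x = t at hx ⊢
      revert s t
      decide
  refine ⟨hiff, fun hbound => hiff.mpr fun β₁ β₂ h₁ h₂ h heq => ?_⟩
  have b₁ := hbound β₁ h₁
  have b₂ := hbound β₂ h₂
  have b₃ := hbound (β₁ + β₂) (hne _ _ h)
  have a₁ := neg_abs_le (W β₁)
  have a₂ := neg_abs_le (W β₂)
  have a₃ := le_abs_self (W (β₁ + β₂))
  linarith
end

section
/- Let D ⊆ F_p^m be a subset satisfying yD = D for every y ∈ F_p^*. Then for every nonzero β ∈ F_p^m: Σ_{x∈D} ζ_p^{−⟨β,x⟩} = (1/(p−1))·( −|D| + p·|{x ∈ D : ⟨β,x⟩ = 0}| ). -/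
open Finset

/-- The negative powers of `exp (2πi/N)` are the values of the standard additive character. -/
lemma exp_zpow_neg_val_eq_stdAddChar {N : ℕ} [NeZero N] (a : ZMod N) :
    Complex.exp (2 * Real.pi * Complex.I / N) ^ (-(a.val : ℤ)) = ZMod.stdAddChar (-a) := by
  rw [AddChar.map_neg_eq_inv, ZMod.stdAddChar_apply, ZMod.toCircle_apply, zpow_neg, zpow_natCast,
    ← Complex.exp_nat_mul]
  congr 2
  ring

/-- Summing a function over a set is unaffected by rescaling by a unit that preserves the set. -/
lemma sum_smul_eq_of_image_smul_eq {K V M : Type*} [Field K] [AddCommGroup V] [Module K V]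
    [DecidableEq V] [AddCommMonoid M] {D : Finset V} {y : K} (hy : y ≠ 0)
    (hD : D.image (fun x => y • x) = D) (f : V → M) :
    ∑ x ∈ D, f (y • x) = ∑ x ∈ D, f x := by
  conv_rhs => rw [← hD]
  exact (sum_image fun _ _ _ _ h => smul_right_injective V hy h).symm

/-- Let `D ⊆ F_p^m` with `yD = D` for every `y ∈ F_p^*`. Then for every
nonzero `β ∈ F_p^m`:
`Σ_{x ∈ D} ζ_p^{−⟨β,x⟩} = (1/(p−1))·(−|D| + p·|{x ∈ D : ⟨β,x⟩ = 0}|)`. -/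
theorem char_sum_of_scalar_invariant_set
    {p m : ℕ} [Fact p.Prime]
    (D : Finset (Fin m → ZMod p))
    (hD : ∀ y : ZMod p, y ≠ 0 → D.image (fun x => y • x) = D) :
    -- the primitive `p`-th root of unity `ζ_p = exp(2πi/p)`
    let ζ : ℂ := Complex.exp (2 * Real.pi * Complex.I / p)
    ∀ β : Fin m → ZMod p, β ≠ 0 →
      (∑ x ∈ D, ζ ^ (-(((∑ i, β i * x i) : ZMod p).val : ℤ))) =
        (1 / ((p : ℂ) - 1)) *
          (-(D.card : ℂ) + (p : ℂ) * ((D.filter (fun x => (∑ i, β i * x i) = 0)).card)) := by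
  intro ζ β _
  have hp : 1 < p := (Fact.out : p.Prime).one_lt
  have hp1 : (p : ℂ) - 1 ≠ 0 := sub_ne_zero.mpr (by exact_mod_cast hp.ne')
  simp only [ζ, exp_zpow_neg_val_eq_stdAddChar]
  set S : ℂ := ∑ x ∈ D, ZMod.stdAddChar (-∑ i, β i * x i) with hS
  have inner_sum (x : Fin m → ZMod p) :
      ∑ y : ZMod p, ZMod.stdAddChar (-∑ i, β i * (y • x) i) =
        if ∑ i, β i * x i = 0 then (p : ℂ) else 0 := by
    have h := AddChar.sum_mulShift (-∑ i, β i * x i) (ZMod.isPrimitive_stdAddChar p)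
    simp only [neg_eq_zero, ZMod.card] at h
    push_cast at h
    rw [← h]
    refine sum_congr rfl fun y _ => ?_
    simp only [Pi.smul_apply, smul_eq_mul, mul_neg, mul_sum, mul_left_comm]
  have outer_sum : ∑ y : ZMod p, ∑ x ∈ D, ZMod.stdAddChar (-∑ i, β i * (y • x) i) =
      (D.card : ℂ) + (p - 1) * S := by
    rw [← add_sum_erase _ _ (mem_univ (0 : ZMod p)), sum_congr rfl fun y hy =>
      sum_smul_eq_of_image_smul_eq (ne_of_mem_erase hy) (hD y (ne_of_mem_erase hy))
        fun x => (ZMod.stdAddChar (-∑ i, β i * x i) : ℂ)]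
    simp [← hS, ZMod.card, Nat.cast_sub hp.le]
  rw [sum_comm, sum_congr rfl fun x _ => inner_sum x, ← sum_filter, sum_const,
    nsmul_eq_mul] at outer_sum
  field_simp
  linear_combination -outer_sum
end
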